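/- arXiv:1210.1982 — 3 statements merged into one kernel-verified Lean document; each statement's English description precedes it below -/
import Mathlib

section
/- Let R be a commutative noetherian ring and M a finitely generated R-module such that M_p is free over R_p for every prime p ∈ V(x) for some x... (contrapositive form): if x₁, …, xₙ ∈ R annihilate all Ext^q_R(M, Ω^r M) for 1 ≤ q, r ≤ n, and x₁, …, xₙ form a regular sequence on M, then the n-th syzygy of M/(x₁,…,xₙ)M is isomorphic (up to projective summands) to the direct sum ⊕_{k=0}^{n} (Ω^k M)^{⊕ binom(n,k)}. -/
open CategoryTheory Opposite Function

universe u

theorem kill_homology {R : Type u} [CommRing R] (C : CochainComplex (ModuleCat.{u} R) ℕ) (k : ℕ)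
    (x : R) (h : ∀ e : C.homology (k+1), x • e = 0) (z : C.X (k+1))
    (hz : (C.d (k+1) (k+2)).hom z = 0) : ∃ y : C.X k, (C.d k (k+1)).hom y = x • z := by
  let S := C.sc' k (k+1) (k+2)
  let e : C.homology (k+1) ≅ S.homology :=
    ShortComplex.homologyMapIso (C.isoSc' k (k+1) (k+2) (by simp) (by simp))
  let e' := e ≪≫ S.moduleCatHomologyIso
  have h' : ∀ w : S.moduleCatLeftHomologyData.H, x • w = 0 := by
    intro w
    have := h (e'.inv.hom w)
    rw [← map_smul] at this
    have h2 := congrArg e'.hom.hom this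
    rw [map_zero] at h2
    have h3 : e'.hom.hom (e'.inv.hom (x • w)) = x • w := by
      rw [← ModuleCat.comp_apply, Iso.inv_hom_id]; rfl
    rw [← h3, h2]
  let zz : LinearMap.ker S.g.hom := ⟨z, hz⟩
  have h4 : (LinearMap.range S.moduleCatToCycles).mkQ (x • zz) = 0 := by
    rw [map_smul]; exact h' _
  rw [Submodule.mkQ_apply, Submodule.Quotient.mk_eq_zero] at h4
  obtain ⟨y, hy⟩ := h4
  exact ⟨y, congrArg Subtype.val hy⟩

section
variable {R : Type u} [CommRing R] 
    (M : Type u) [AddCommGroup M] [Module R M]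
    (K : ℕ → Type u) [∀ i, AddCommGroup (K i)] [∀ i, Module R (K i)]
    (P : ℕ → Type u) [∀ i, AddCommGroup (P i)] [∀ i, Module R (P i)]
    (e₀ : K 0 ≃ₗ[R] M)
    (π : ∀ i, P i →ₗ[R] K i)
    (ι : ∀ i, K (i + 1) →ₗ[R] P i)
    (hexact : ∀ i, LinearMap.range (ι i) = LinearMap.ker (π i))

theorem pi_iota (hexact : ∀ i, LinearMap.range (ι i) = LinearMap.ker (π i)) (i : ℕ) (a : K (i+1)) :
    π i (ι i a) = 0 := by
  have : ι i a ∈ LinearMap.ker (π i) := by rw [← hexact]; exact ⟨a, rfl⟩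
  exact this

noncomputable def resCx (hexact : ∀ i, LinearMap.range (ι i) = LinearMap.ker (π i)) :
    ChainComplex (ModuleCat.{u} R) ℕ :=
  ChainComplex.of (fun i => ModuleCat.of R (P i))
    (fun i => ModuleCat.ofHom (ι i ∘ₗ π (i+1))) (by
      intro i
      ext a
      simp [pi_iota K P π ι hexact])

theorem resCx_d (i : ℕ) : (resCx K P π ι hexact).d (i+1) i = ModuleCat.ofHom (ι i ∘ₗ π (i+1)) :=
  ChainComplex.of_d (fun i => ModuleCat.of R (P i)) (fun i => ModuleCat.ofHom (ι i ∘ₗ π (i+1))) i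

theorem resCx_exact (hπ : ∀ i, Surjective (π i)) (hι : ∀ i, Injective (ι i)) (i : ℕ) : (resCx K P π ι hexact).ExactAt (i+1) := by
  rw [HomologicalComplex.exactAt_iff' _ (i + 1 + 1) (i + 1) i (by simp) (by simp)]
  rw [ShortComplex.moduleCat_exact_iff]
  intro (a : P (i+1)) ha
  replace ha : ((resCx K P π ι hexact).d (i+1) i).hom a = 0 := ha
  rw [resCx_d] at ha
  have h1 : π (i+1) a = 0 := hι i (by rw [map_zero]; exact ha)
  have h2 : a ∈ LinearMap.range (ι (i+1)) := by rw [hexact]; exact h1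
  obtain ⟨b, rfl⟩ := h2
  obtain ⟨c, rfl⟩ := hπ _ b
  refine ⟨c, ?_⟩
  change ((resCx K P π ι hexact).d (i+1+1) (i+1)).hom c = _
  rw [resCx_d]
  rfl

noncomputable def resAug : (resCx K P π ι hexact).X 0 ⟶ ModuleCat.of R M :=
  ModuleCat.ofHom (e₀.toLinearMap ∘ₗ π 0)

theorem resCx_aug : (resCx K P π ι hexact).d 1 0 ≫ resAug M K P e₀ π ι hexact = 0 := by
  rw [resCx_d]
  ext a
  change e₀ (π 0 (ι 0 (π 1 a))) = 0
  rw [pi_iota K P π ι hexact, map_zero]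

theorem exists_res (hPproj : ∀ i, Module.Projective R (P i)) (hπ : ∀ i, Surjective (π i)) (hι : ∀ i, Injective (ι i)) (e₀ : K 0 ≃ₗ[R] M)
     : ∃ X : ProjectiveResolution (ModuleCat.of R M), X.complex = resCx K P π ι hexact := by
  refine ⟨{ complex := resCx K P π ι hexact
            projective := fun n => ?_
            π := (ChainComplex.toSingle₀Equiv _ _).symm ⟨resAug M K P e₀ π ι hexact, resCx_aug M K P e₀ π ι hexact⟩
            quasiIso := ⟨fun n => ?_⟩ }, rfl⟩
  · have := hPproj n
    exact (IsProjective.iff_projective (R := R) (P n)).1 this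
  · cases n with
    | zero =>
      rw [ChainComplex.quasiIsoAt₀_iff, ShortComplex.quasiIso_iff_of_zeros' ]
      · constructor
        · rw [ShortComplex.moduleCat_exact_iff]
          intro (a : P 0) ha
          replace ha : (((ChainComplex.toSingle₀Equiv (resCx K P π ι hexact) (ModuleCat.of R M)).symm
            ⟨resAug M K P e₀ π ι hexact, resCx_aug M K P e₀ π ι hexact⟩).f 0).hom a = 0 := ha
          rw [ChainComplex.toSingle₀Equiv_symm_apply_f_zero] at ha
          replace ha : e₀ (π 0 a) = 0 := ha
          have h1 : π 0 a = 0 := by simpa using ha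
          have h2 : a ∈ LinearMap.range (ι 0) := by rw [hexact]; exact h1
          obtain ⟨b, rfl⟩ := h2
          obtain ⟨c, rfl⟩ := hπ _ b
          refine ⟨c, ?_⟩
          change ((resCx K P π ι hexact).d (0+1) 0).hom c = _
          rw [resCx_d]
          rfl
        · change Epi (((ChainComplex.toSingle₀Equiv (resCx K P π ι hexact) (ModuleCat.of R M)).symm
            ⟨resAug M K P e₀ π ι hexact, resCx_aug M K P e₀ π ι hexact⟩).f 0)
          rw [ChainComplex.toSingle₀Equiv_symm_apply_f_zero]
          refine (ModuleCat.epi_iff_surjective _).2 ?_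
          exact e₀.surjective.comp (hπ 0)
      all_goals rfl
    | succ n =>
      rw [quasiIsoAt_iff_exactAt']
      · exact resCx_exact K P π ι hexact hπ hι n
      · apply ChainComplex.exactAt_succ_single_obj

theorem ext_kill (hexact : ∀ i, LinearMap.range (ι i) = LinearMap.ker (π i))
    (hPproj : ∀ i, Module.Projective R (P i)) (hπ : ∀ i, Surjective (π i)) (hι : ∀ i, Injective (ι i)) (e₀ : K 0 ≃ₗ[R] M)
     (k : ℕ) (x : R) 
    (hx : ∀ e : ((Ext R (ModuleCat.{u} R) (k+1)).obj (op (ModuleCat.of R M))).obj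
        (ModuleCat.of R (K (k+1))), x • e = 0) :
    ∃ g : K k →ₗ[R] P k, ∀ a, π k (g a) = x • a := by
  obtain ⟨X, hX⟩ := exists_res M K P π ι hexact hPproj hπ hι e₀
  obtain ⟨y, hy⟩ : ∃ y : P k →ₗ[R] K (k+1), y ∘ₗ (ι k ∘ₗ π (k+1)) = x • π (k+1) := by
    let e := X.isoExt (R := R) (k+1) (ModuleCat.of R (K (k+1)))
    have h := kill_homology (X.complex.linearYonedaObj R (ModuleCat.of R (K (k+1)))) k x (by
      intro w
      have := hx (e.inv.hom w)
      rw [← map_smul] at this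
      have h2 := congrArg e.hom.hom this
      rw [map_zero] at h2
      have h3 : e.hom.hom (e.inv.hom (x • w)) = x • w := by
        rw [← ModuleCat.comp_apply, Iso.inv_hom_id]; rfl
      rw [← h3, h2])
    clear e hx
    rw [hX] at h
    obtain ⟨y, hy⟩ := h (ModuleCat.ofHom (π (k+1))) (by
      change (resCx K P π ι hexact).d (k+2) (k+1) ≫ _ = 0
      rw [resCx_d]
      ext a
      change π (k+1) (ι (k+1) (π (k+2) a)) = 0
      rw [pi_iota K P π ι hexact])
    replace hy : (resCx K P π ι hexact).d (k+1) k ≫ y = x • (ModuleCat.ofHom (π (k+1))) := hy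
    rw [resCx_d] at hy
    exact ⟨ModuleCat.Hom.hom y, congrArg ModuleCat.Hom.hom hy⟩
  have hy' : ∀ a, y (ι k a) = x • a := by
    intro a
    obtain ⟨b, rfl⟩ := hπ _ a
    exact LinearMap.congr_fun hy b
  let f : P k →ₗ[R] P k := x • LinearMap.id - ι k ∘ₗ y
  have hf : LinearMap.ker (π k) ≤ LinearMap.ker f := by
    rw [← hexact]
    rintro _ ⟨a, rfl⟩
    simp [f, hy']
  let q := (π k).quotKerEquivOfSurjective (hπ k)
  refine ⟨(LinearMap.ker (π k)).liftQ f hf ∘ₗ q.symm.toLinearMap, fun a => ?_⟩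
  obtain ⟨b, rfl⟩ := hπ _ a
  have : q.symm (π k b) = Submodule.Quotient.mk b := by
    rw [LinearEquiv.symm_apply_eq]; rfl
  simp [this, f, pi_iota K P π ι hexact]
end

section stable
variable (R : Type u) [CommRing R]

/-- stable equivalence -/
def StEq (A B : Type u) [AddCommGroup A] [Module R A] [AddCommGroup B] [Module R B] : Prop :=
  ∃ Q₁ Q₂ : ModuleCat.{u} R,
        Module.Projective R Q₁ ∧ Module.Finite R Q₁ ∧
        Module.Projective R Q₂ ∧ Module.Finite R Q₂ ∧
        Nonempty ((A × Q₁) ≃ₗ[R] (B × Q₂))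

/-- `C` is a first syzygy of `B` -/
def Syz (C B : Type u) [AddCommGroup C] [Module R C] [AddCommGroup B] [Module R B] : Prop :=
  ∃ (F : ModuleCat.{u} R) (π : F →ₗ[R] B) (ι : C →ₗ[R] F), Module.Projective R F ∧
    Module.Finite R F ∧ Surjective π ∧ Injective ι ∧ LinearMap.range ι = LinearMap.ker π

/-- `L` is an `n`-th syzygy of `N` -/
def SyzN : ℕ → ModuleCat.{u} R → ModuleCat.{u} R → Prop
  | 0, L, N => Nonempty (L ≃ₗ[R] N)
  | n + 1, L, N => ∃ B : ModuleCat.{u} R, SyzN n B N ∧ Syz R L B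

/-- multiplication by `x` factors through a projective -/
def SF (x : R) (A : Type u) [AddCommGroup A] [Module R A] : Prop :=
  ∃ (Q : ModuleCat.{u} R) (f : A →ₗ[R] Q) (g : Q →ₗ[R] A), Module.Projective R Q ∧
    ∀ a, g (f a) = x • a

variable {R}
variable {A B C D : Type u} [AddCommGroup A] [Module R A] [AddCommGroup B] [Module R B]
  [AddCommGroup C] [Module R C] [AddCommGroup D] [Module R D]

theorem StEq.of_equiv (e : A ≃ₗ[R] B) : StEq R A B :=
  ⟨ModuleCat.of R PUnit.{u+1}, ModuleCat.of R PUnit.{u+1}, inferInstanceAs (Module.Projective R PUnit.{u+1}),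
    inferInstanceAs (Module.Finite R PUnit.{u+1}), inferInstanceAs (Module.Projective R PUnit.{u+1}),
    inferInstanceAs (Module.Finite R PUnit.{u+1}), ⟨e.prodCongr (LinearEquiv.refl R _)⟩⟩

theorem StEq.symm (h : StEq R A B) : StEq R B A := by
  obtain ⟨Q₁, Q₂, a, b, c, d, ⟨e⟩⟩ := h
  exact ⟨Q₂, Q₁, c, d, a, b, ⟨e.symm⟩⟩

theorem StEq.trans (h : StEq R A B) (h' : StEq R B C) : StEq R A C := by
  obtain ⟨Q₁, Q₂, _, _, _, _, ⟨e⟩⟩ := h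
  obtain ⟨S₁, S₂, _, _, _, _, ⟨f⟩⟩ := h'
  refine ⟨ModuleCat.of R (Q₁ × S₁), ModuleCat.of R (S₂ × Q₂), inferInstanceAs (Module.Projective R (Q₁ × S₁)),
    inferInstanceAs (Module.Finite R (Q₁ × S₁)), inferInstanceAs (Module.Projective R (S₂ × Q₂)),
    inferInstanceAs (Module.Finite R (S₂ × Q₂)), ⟨?_⟩⟩
  let e1 : (A × (Q₁ × S₁)) ≃ₗ[R] (C × (S₂ × Q₂)) :=
    (LinearEquiv.prodAssoc R A Q₁ S₁).symm ≪≫ₗ e.prodCongr (LinearEquiv.refl R S₁) ≪≫ₗ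
    LinearEquiv.prodAssoc R B Q₂ S₁ ≪≫ₗ
    (LinearEquiv.refl R B).prodCongr (LinearEquiv.prodComm R Q₂ S₁) ≪≫ₗ
    (LinearEquiv.prodAssoc R B S₁ Q₂).symm ≪≫ₗ f.prodCongr (LinearEquiv.refl R Q₂) ≪≫ₗ
    LinearEquiv.prodAssoc R C S₂ Q₂
  exact e1

theorem StEq.prod (h : StEq R A B) (h' : StEq R C D) : StEq R (A × C) (B × D) := by
  obtain ⟨Q₁, Q₂, _, _, _, _, ⟨e⟩⟩ := h
  obtain ⟨S₁, S₂, _, _, _, _, ⟨f⟩⟩ := h'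
  refine ⟨ModuleCat.of R (Q₁ × S₁), ModuleCat.of R (Q₂ × S₂), inferInstanceAs (Module.Projective R (Q₁ × S₁)),
    inferInstanceAs (Module.Finite R (Q₁ × S₁)), inferInstanceAs (Module.Projective R (Q₂ × S₂)),
    inferInstanceAs (Module.Finite R (Q₂ × S₂)), ⟨?_⟩⟩
  let e1 : ((A × C) × (Q₁ × S₁)) ≃ₗ[R] ((B × D) × (Q₂ × S₂)) :=
    LinearEquiv.prodProdProdComm R A C Q₁ S₁ ≪≫ₗ e.prodCongr f ≪≫ₗ
    LinearEquiv.prodProdProdComm R B Q₂ D S₂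
  exact e1

/-- pullback -/
def PB {F Q : Type u} [AddCommGroup F] [Module R F] [AddCommGroup Q] [Module R Q]
    (π : F →ₗ[R] B) (f : Q →ₗ[R] B) : Submodule R (F × Q) where
  carrier := {p | π p.1 = f p.2}
  add_mem' := by
    intro a b ha hb
    simp only [Set.mem_ofPred_eq] at *
    simp [ha, hb]
  zero_mem' := by simp
  smul_mem' := by
    intro c a ha
    simp only [Set.mem_ofPred_eq] at *
    simp [ha]

theorem PB_split {F Q : Type u} [AddCommGroup F] [Module R F] [AddCommGroup Q] [Module R Q]
    (π : F →ₗ[R] B) (f : Q →ₗ[R] B) (ι : C →ₗ[R] F) (hι : Injective ι)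
    (hex : LinearMap.range ι = LinearMap.ker π) (s : Q →ₗ[R] F) (hs : ∀ q, π (s q) = f q) :
    Nonempty ((C × Q) ≃ₗ[R] PB π f) := by
  have hc : ∀ c, π (ι c) = 0 := fun c => by
    have : ι c ∈ LinearMap.ker π := by rw [← hex]; exact ⟨c, rfl⟩
    exact this
  let φ : (C × Q) →ₗ[R] PB π f :=
    LinearMap.codRestrict (PB π f) ((ι.coprod s).prod (LinearMap.snd R C Q)) (by
      rintro ⟨c, q⟩
      change π (ι c + s q) = f q
      rw [map_add, hc, hs, zero_add])
  refine ⟨LinearEquiv.ofBijective φ ⟨?_, ?_⟩⟩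
  · rw [injective_iff_map_eq_zero]
    rintro ⟨c, q⟩ h
    have h1 : (ι c + s q, q) = (0 : F × Q) := congrArg Subtype.val h
    simp only [Prod.mk_eq_zero] at h1
    obtain ⟨h1, rfl⟩ := h1
    rw [map_zero, add_zero] at h1
    have : c = 0 := hι (by rw [h1, map_zero])
    rw [this]; rfl
  · rintro ⟨⟨a, q⟩, h⟩
    replace h : π a = f q := h
    have : a - s q ∈ LinearMap.range ι := by
      rw [hex, LinearMap.mem_ker, map_sub, h, hs, sub_self]
    obtain ⟨c, hc⟩ := this
    refine ⟨(c, q), Subtype.ext ?_⟩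
    change (ι c + s q, q) = (a, q)
    rw [hc, sub_add_cancel]

/-- the swap on pullbacks -/
theorem PB_swap {F Q : Type u} [AddCommGroup F] [Module R F] [AddCommGroup Q] [Module R Q]
    (π : F →ₗ[R] B) (f : Q →ₗ[R] B) : Nonempty (PB π f ≃ₗ[R] PB f π) := by
  refine ⟨(LinearEquiv.prodComm R F Q).ofSubmodules _ _ ?_⟩
  ext ⟨a, b⟩
  rw [Submodule.mem_map]
  constructor
  · rintro ⟨⟨c, d⟩, h, h'⟩
    cases h'
    exact Eq.symm h
  · intro h
    exact ⟨(b, a), Eq.symm h, rfl⟩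

theorem schanuel {F G : Type u} [AddCommGroup F] [Module R F] [AddCommGroup G] [Module R G]
    [Module.Projective R F] [Module.Projective R G] [Module.Finite R F] [Module.Finite R G]
    (π : F →ₗ[R] B) (hπ : Surjective π) (ι : C →ₗ[R] F) (hι : Injective ι)
    (hex : LinearMap.range ι = LinearMap.ker π)
    (ρ : G →ₗ[R] B) (hρ : Surjective ρ) (j : D →ₗ[R] G) (hj : Injective j)
    (hex' : LinearMap.range j = LinearMap.ker ρ) : StEq R C D := by
  obtain ⟨s, hs⟩ := Module.projective_lifting_property π ρ hπ
  obtain ⟨t, ht⟩ := Module.projective_lifting_property ρ π hρ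
  obtain ⟨e⟩ := PB_split π ρ ι hι hex s (fun q => LinearMap.congr_fun hs q)
  obtain ⟨f⟩ := PB_split ρ π j hj hex' t (fun q => LinearMap.congr_fun ht q)
  obtain ⟨g⟩ := PB_swap π ρ
  exact ⟨ModuleCat.of R G, ModuleCat.of R F, ‹_›, ‹_›, ‹_›, ‹_›, ⟨e ≪≫ₗ g ≪≫ₗ f.symm⟩⟩

theorem Syz.stEq (h : StEq R A B) (hA : Syz R C A) (hB : Syz R D B) : StEq R C D := by
  obtain ⟨Q₁, Q₂, _, _, _, _, ⟨e⟩⟩ := h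
  obtain ⟨F, π, ι, _, _, hπ, hι, hex⟩ := hA
  obtain ⟨G, ρ, j, _, _, hρ, hj, hex'⟩ := hB
  refine schanuel (F := F × Q₁) (G := G × Q₂) (B := B × Q₂)
    (e.toLinearMap ∘ₗ π.prodMap LinearMap.id) ?_ (LinearMap.inl R F Q₁ ∘ₗ ι) ?_ ?_
    (ρ.prodMap LinearMap.id) ?_ (LinearMap.inl R G Q₂ ∘ₗ j) ?_ ?_
  · exact e.surjective.comp (hπ.prodMap surjective_id)
  · exact LinearMap.inl_injective.comp hι
  · rw [LinearMap.range_comp, hex, LinearEquiv.ker_comp]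
    ext ⟨a, b⟩
    simp [LinearMap.mem_ker, eq_comm]
  · exact hρ.prodMap surjective_id
  · exact LinearMap.inl_injective.comp hj
  · rw [LinearMap.range_comp, hex']
    ext ⟨a, b⟩
    simp [LinearMap.mem_ker, eq_comm]

theorem SyzN.stEq {N : ModuleCat.{u} R} : ∀ (n : ℕ) {L L' : ModuleCat.{u} R}, SyzN R n L N →
    SyzN R n L' N → StEq R L L'
  | 0, _, _, ⟨e⟩, ⟨f⟩ => StEq.of_equiv (e ≪≫ₗ f.symm)
  | n + 1, _, _, ⟨_, h, s⟩, ⟨_, h', s'⟩ => Syz.stEq (SyzN.stEq n h h') s s'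

theorem exists_cover [Module.Finite R B] : ∃ (F : ModuleCat.{u} R) (π : F →ₗ[R] B),
    Module.Projective R F ∧ Module.Finite R F ∧ Surjective π := by
  obtain ⟨n, f, hf⟩ := Module.Finite.exists_fin' R B
  exact ⟨ModuleCat.of R (Fin n → R), f, inferInstanceAs (Module.Projective R (Fin n → R)),
    inferInstanceAs (Module.Finite R (Fin n → R)), hf⟩

theorem exists_syzN [IsNoetherianRing R] (N : ModuleCat.{u} R) [Module.Finite R N] (n : ℕ) :
    ∃ L : ModuleCat.{u} R, SyzN R n L N ∧ Module.Finite R L := by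
  induction n with
  | zero => exact ⟨N, ⟨LinearEquiv.refl R N⟩, ‹_›⟩
  | succ n ih =>
    obtain ⟨B, hB, _⟩ := ih
    obtain ⟨F, π, _, _, hπ⟩ := exists_cover (R := R) (B := B)
    exact ⟨ModuleCat.of R (LinearMap.ker π), ⟨B, hB, F, π, (LinearMap.ker π).subtype, ‹_›, ‹_›, hπ,
      Subtype.val_injective, Submodule.range_subtype _⟩, inferInstanceAs (Module.Finite R (LinearMap.ker π))⟩

theorem SF.lift {x : R} (h : SF R x B) {F : Type u} [AddCommGroup F] [Module R F] (π : F →ₗ[R] B)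
    (hπ : Surjective π) : ∃ s : B →ₗ[R] F, ∀ b, π (s b) = x • b := by
  obtain ⟨Q, f, g, _, h⟩ := h
  obtain ⟨s, hs⟩ := Module.projective_lifting_property π g hπ
  refine ⟨s ∘ₗ f, fun b => ?_⟩
  rw [← h]
  exact LinearMap.congr_fun hs (f b)

theorem SF.of_stEq {x : R} (h : SF R x B) (e : StEq R A B) : SF R x A := by
  obtain ⟨Q₁, Q₂, _, _, _, _, ⟨e⟩⟩ := e
  obtain ⟨Q, f, g, _, h⟩ := h
  refine ⟨ModuleCat.of R (Q × Q₂), (f.prodMap LinearMap.id) ∘ₗ e.toLinearMap ∘ₗ LinearMap.inl R A Q₁,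
    LinearMap.fst R A Q₁ ∘ₗ e.symm.toLinearMap ∘ₗ (g.prodMap (x • LinearMap.id)),
    inferInstanceAs (Module.Projective R (Q × Q₂)), fun a => ?_⟩
  have : (g.prodMap (x • LinearMap.id)) ((f.prodMap LinearMap.id) (e (a, 0))) = x • e (a, 0) := by
    ext <;> simp [h]
  change (e.symm ((g.prodMap (x • LinearMap.id)) ((f.prodMap LinearMap.id) (e (a, 0))))).1 = _
  rw [this, map_smul, LinearEquiv.symm_apply_apply]
  rfl

theorem SF.pi {I : Type} [Finite I] {x : R} (V : I → Type u) [∀ i, AddCommGroup (V i)]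
    [∀ i, Module R (V i)] (h : ∀ i, SF R x (V i)) : SF R x (∀ i, V i) := by
  classical
  cases nonempty_fintype I
  choose Q f g hQ h using h
  refine ⟨ModuleCat.of R (∀ i, Q i), LinearMap.pi fun i => f i ∘ₗ LinearMap.proj i,
    LinearMap.pi fun i => g i ∘ₗ LinearMap.proj i, ?_, ?_⟩
  · exact Module.Projective.of_equiv (DirectSum.linearEquivFunOnFintype R I (fun i => Q i))
  · intro a
    ext i
    simp [h]

theorem syz_PB_zero {N N' : Type u} [AddCommGroup N] [Module R N] [AddCommGroup N'] [Module R N']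
    (x : R) (hx : IsSMulRegular N x) (ρ : N →ₗ[R] N') (hρ : Surjective ρ)
    (hker : ∀ a, ρ a = 0 ↔ ∃ b, a = x • b) (e : B ≃ₗ[R] N)
    (F : ModuleCat.{u} R) [Module.Projective R F] [Module.Finite R F] (π : F →ₗ[R] B)
    (hπ : Surjective π) : Syz R (PB π (x • LinearMap.id)) N' := by
  refine ⟨F, ρ ∘ₗ e.toLinearMap ∘ₗ π, LinearMap.fst R F B ∘ₗ (PB π (x • LinearMap.id)).subtype,
    ‹_›, ‹_›, hρ.comp (e.surjective.comp hπ), ?_, ?_⟩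
  · rw [injective_iff_map_eq_zero]
    rintro ⟨⟨a, b⟩, h⟩ h'
    replace h : π a = x • b := h
    replace h' : a = 0 := h'
    subst h'
    rw [map_zero] at h
    have : e b = 0 := hx (by simp [← map_smul, ← h])
    have : b = 0 := by simpa using this
    subst this
    rfl
  · ext a
    rw [LinearMap.mem_range, LinearMap.mem_ker]
    change _ ↔ ρ (e (π a)) = 0
    rw [hker]
    constructor
    · rintro ⟨⟨⟨a, b⟩, h⟩, rfl⟩
      exact ⟨e b, (congrArg e h).trans (by simp)⟩
    · rintro ⟨b, h⟩
      refine ⟨⟨(a, e.symm b), ?_⟩, rfl⟩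
      change π a = x • e.symm b
      rw [← map_smul, ← h, LinearEquiv.symm_apply_apply]

theorem syz_PB_succ (x : R) 
    (F : ModuleCat.{u} R) [Module.Projective R F] [Module.Finite R F] (π : F →ₗ[R] B)
    (hπ : Surjective π) (ι : C →ₗ[R] F) (hι : Injective ι)
    (hex : LinearMap.range ι = LinearMap.ker π)
    (G : ModuleCat.{u} R) [Module.Projective R G] [Module.Finite R G] (ρ : G →ₗ[R] C)
    (hρ : Surjective ρ) :
    Syz R (PB ρ (x • LinearMap.id)) (PB π (x • LinearMap.id)) := by
  have hc : ∀ c, π (ι c) = 0 := fun c => by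
    have : ι c ∈ LinearMap.ker π := by rw [← hex]; exact ⟨c, rfl⟩
    exact this
  let φ : (G × F) →ₗ[R] PB π (x • LinearMap.id) :=
    LinearMap.codRestrict _ (((ι ∘ₗ ρ).coprod (x • LinearMap.id)).prod (π ∘ₗ LinearMap.snd R G F)) (by
      rintro ⟨c, b⟩
      change π (ι (ρ c) + x • b) = x • π b
      rw [map_add, hc, map_smul, zero_add])
  let ψ : PB ρ (x • LinearMap.id) →ₗ[R] (G × F) :=
    (LinearMap.id.prodMap (-ι)) ∘ₗ (PB ρ (x • LinearMap.id)).subtype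
  refine ⟨ModuleCat.of R (G × F), φ, ψ, inferInstanceAs (Module.Projective R (G × F)),
    inferInstanceAs (Module.Finite R (G × F)), ?_, ?_, ?_⟩
  · rintro ⟨⟨a, k⟩, h⟩
    replace h : π a = x • k := h
    obtain ⟨b, rfl⟩ := hπ k
    have : a - x • b ∈ LinearMap.range ι := by
      rw [hex, LinearMap.mem_ker, map_sub, h, map_smul, sub_self]
    obtain ⟨k', hk'⟩ := this
    obtain ⟨c, rfl⟩ := hρ k'
    refine ⟨(c, b), Subtype.ext ?_⟩
    change (ι (ρ c) + x • b, π b) = (a, π b)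
    rw [hk', sub_add_cancel]
  · rw [injective_iff_map_eq_zero]
    rintro ⟨⟨a, b⟩, h⟩ h'
    replace h' : (a, -ι b) = (0 : G × F) := h'
    simp only [Prod.mk_eq_zero, neg_eq_zero] at h'
    obtain ⟨rfl, h'⟩ := h'
    have : b = 0 := hι (by rw [h', map_zero])
    subst this
    rfl
  · ext ⟨c, b⟩
    rw [LinearMap.mem_range, LinearMap.mem_ker]
    constructor
    · rintro ⟨⟨⟨a, k⟩, h⟩, h'⟩
      replace h : ρ a = x • k := h
      replace h' : (a, -ι k) = (c, b) := h'
      rw [← h']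
      refine Subtype.ext ?_
      change (ι (ρ a) + x • (-ι k), π (-ι k)) = 0
      simp [h, hc]
    · intro h
      replace h : (ι (ρ c) + x • b, π b) = 0 := congrArg Subtype.val h
      simp only [Prod.mk_eq_zero] at h
      obtain ⟨h1, h2⟩ := h
      have : b ∈ LinearMap.range ι := by rw [hex]; exact h2
      obtain ⟨k, rfl⟩ := this
      refine ⟨⟨(c, -k), ?_⟩, ?_⟩
      · change ρ c = x • (-k)
        apply hι
        rw [map_smul, map_neg, smul_neg]
        exact eq_neg_of_add_eq_zero_left h1
      · change (c, -ι (-k)) = (c, ι k)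
        simp

theorem syzN_PB {N N' : ModuleCat.{u} R}
    (x : R) (hx : IsSMulRegular N x) (ρ : N →ₗ[R] N') (hρ : Surjective ρ)
    (hker : ∀ a, ρ a = 0 ↔ ∃ b, a = x • b) (n : ℕ) : ∀ (B : ModuleCat.{u} R), SyzN R n B N →
    ∀ (F : ModuleCat.{u} R) (_ : Module.Projective R F) (_ : Module.Finite R F) (π : F →ₗ[R] B)
    (_ : Surjective π), SyzN R (n + 1) (ModuleCat.of R (PB π (x • LinearMap.id))) N' := by
  induction n with
  | zero =>
    rintro B ⟨e⟩ F _ _ π hπ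
    exact ⟨N', ⟨LinearEquiv.refl R N'⟩, syz_PB_zero x hx ρ hρ hker e F π hπ⟩
  | succ n ih =>
    rintro B ⟨B₀, h₀, G, σ, j, _, _, hσ, hj, hex⟩ F _ _ π hπ
    exact ⟨_, ih B₀ h₀ G ‹_› ‹_› σ hσ, syz_PB_succ x G σ hσ j hj hex F π hπ⟩

theorem Syz.pi {I : Type} [Finite I] (V W : I → Type u) [∀ i, AddCommGroup (V i)]
    [∀ i, Module R (V i)] [∀ i, AddCommGroup (W i)]
    [∀ i, Module R (W i)] (h : ∀ i, Syz R (V i) (W i)) : Syz R (∀ i, V i) (∀ i, W i) := by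
  classical
  cases nonempty_fintype I
  choose F π ι hF hF' hπ hι hex using h
  refine ⟨ModuleCat.of R (∀ i, F i), LinearMap.pi fun i => π i ∘ₗ LinearMap.proj i,
    LinearMap.pi fun i => ι i ∘ₗ LinearMap.proj i, ?_, ?_, ?_, ?_, ?_⟩
  · exact Module.Projective.of_equiv (DirectSum.linearEquivFunOnFintype R I (fun i => F i))
  · exact inferInstanceAs (Module.Finite R (∀ i, F i))
  · intro w
    choose a ha using fun i => hπ i (w i)
    exact ⟨a, funext ha⟩
  · intro v w h
    funext i
    exact hι i (congrFun h i)
  · ext a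
    rw [LinearMap.mem_range, LinearMap.mem_ker]
    constructor
    · rintro ⟨v, rfl⟩
      funext i
      have : ι i (v i) ∈ LinearMap.ker (π i) := by rw [← hex]; exact ⟨_, rfl⟩
      exact this
    · intro h
      have : ∀ i, a i ∈ LinearMap.range (ι i) := by
        intro i
        rw [hex]
        exact congrFun h i
      choose v hv using this
      exact ⟨v, funext hv⟩

/-- the one-step result -/
theorem step [IsNoetherianRing R] {N N' : ModuleCat.{u} R} [Module.Finite R N]
    (x : R) (hx : IsSMulRegular N x) (ρ : N →ₗ[R] N') (hρ : Surjective ρ)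
    (hker : ∀ a, ρ a = 0 ↔ ∃ b, a = x • b) (n : ℕ) (S S' : Type u) [AddCommGroup S] [Module R S]
    [AddCommGroup S'] [Module R S'] (hS : ∀ L : ModuleCat.{u} R, SyzN R n L N → StEq R L S)
    (hS' : Syz R S' S) (hSF : SF R x S) :
    ∀ L : ModuleCat.{u} R, SyzN R (n + 1) L N' → StEq R L (S × S') := by
  intro L hL
  obtain ⟨B, hB, _⟩ := exists_syzN N n
  have hBS := hS B hB
  obtain ⟨F, π, _, _, hπ⟩ := exists_cover (R := R) (B := B)
  have h1 := SyzN.stEq _ hL (syzN_PB x hx ρ hρ hker n B hB F ‹_› ‹_› π hπ)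
  obtain ⟨s, hs⟩ := (hSF.of_stEq hBS).lift π hπ
  obtain ⟨e⟩ := PB_split π (x • LinearMap.id) (LinearMap.ker π).subtype Subtype.val_injective
    (Submodule.range_subtype _) s hs
  have h2 : StEq R (LinearMap.ker π) S' := Syz.stEq hBS ⟨F, π, (LinearMap.ker π).subtype, ‹_›, ‹_›, hπ,
      Subtype.val_injective, Submodule.range_subtype _⟩ hS'
  exact h1.trans ((StEq.of_equiv (e.symm ≪≫ₗ LinearEquiv.prodComm R _ _)).trans (hBS.prod h2))

end stable

theorem card_fiber_sum {I : Type} [Finite I] (d : I → ℕ) (n : ℕ)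
    (hd : ∀ k, Nat.card {i // d i = k} = n.choose k) (k : ℕ) :
    Nat.card {i : I ⊕ I // Sum.elim d (fun i => d i + 1) i = k} = (n + 1).choose k := by
  rw [Nat.card_congr (Equiv.subtypeSum), Nat.card_sum]
  simp only [Sum.elim_inl, Sum.elim_inr]
  rw [hd]
  cases k with
  | zero => simp
  | succ k =>
    simp only [Nat.add_right_cancel_iff]
    rw [hd, Nat.choose_succ_succ, add_comm]

/-- transport along an equality of indices -/
def trK {R : Type u} [CommRing R]
    (K : ℕ → Type u) [∀ i, AddCommGroup (K i)] [∀ i, Module R (K i)] {a b : ℕ} (h : a = b) :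
    K a ≃ₗ[R] K b := h ▸ LinearEquiv.refl R (K a)

theorem final_equiv {R : Type u} [CommRing R]
    (K : ℕ → Type u) [∀ i, AddCommGroup (K i)] [∀ i, Module R (K i)]
    {I : Type} [Finite I] (d : I → ℕ) (n : ℕ)
    (hd : ∀ k, Nat.card {i // d i = k} = n.choose k) :
    Nonempty ((∀ i, K (d i)) ≃ₗ[R] ((k : Fin (n + 1)) → Fin (n.choose k.1) → K k.1)) := by
  have hlt : ∀ i, d i < n + 1 := by
    intro i
    by_contra h
    have h1 := hd (d i)
    rw [Nat.choose_eq_zero_of_lt (by omega)] at h1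
    have : Nonempty {j // d j = d i} := ⟨⟨i, rfl⟩⟩
    exact Nat.card_pos.ne' h1
  have E : ∀ k : ℕ, Nonempty (Fin (n.choose k) ≃ {i // d i = k}) := by
    intro k
    rw [← hd k]
    exact ⟨(Finite.equivFin _).symm⟩
  let E := fun k => (E k).some
  let φ : (∀ i, K (d i)) →ₗ[R] ((k : Fin (n + 1)) → Fin (n.choose k.1) → K k.1) :=
    LinearMap.pi fun k => LinearMap.pi fun j =>
      (trK K (E k.1 j).2).toLinearMap ∘ₗ LinearMap.proj (E k.1 j).1
  have hφ : ∀ v i, φ v ⟨d i, hlt i⟩ ((E (d i)).symm ⟨i, rfl⟩) = v i := by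
    intro v i
    have aux : ∀ t : {j // d j = d i}, t = ⟨i, rfl⟩ → trK (R := R) K t.2 (v t.1) = v i := by
      rintro _ rfl
      rfl
    exact aux _ (Equiv.apply_symm_apply _ _)
  refine ⟨LinearEquiv.ofBijective φ ⟨?_, ?_⟩⟩
  · intro v w h
    funext i
    rw [← hφ v, ← hφ w, h]
  · intro w
    refine ⟨fun i => w ⟨d i, hlt i⟩ ((E (d i)).symm ⟨i, rfl⟩), ?_⟩
    funext k j
    obtain ⟨k, hk⟩ := k
    have aux : ∀ t : {j // d j = k}, trK (R := R) K t.2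
        (w ⟨d t.1, hlt _⟩ ((E (d t.1)).symm ⟨t.1, rfl⟩)) = w ⟨k, hk⟩ ((E k).symm t) := by
      rintro ⟨i, rfl⟩
      rfl
    exact (aux (E k j)).trans (by rw [Equiv.symm_apply_apply])

open Pointwise in
theorem main_ind {R : Type u} [CommRing R] [IsNoetherianRing R]
    (M : Type u) [AddCommGroup M] [Module R M] [Module.Finite R M]
    (K : ℕ → Type u) [∀ i, AddCommGroup (K i)] [∀ i, Module R (K i)]
    (e₀ : K 0 ≃ₗ[R] M) (hsyz : ∀ i, Syz R (K (i + 1)) (K i))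
    (l : List R) (hreg : RingTheory.Sequence.IsWeaklyRegular M l)
    (hSF : ∀ (p : ℕ) (hp : p < l.length) (k : ℕ), k ≤ p → SF R l[p] (K k)) (n : ℕ)
    (hn : n ≤ l.length) :
    ∃ (I : Type) (_ : Finite I) (d : I → ℕ), (∀ k, Nat.card {i // d i = k} = n.choose k) ∧
      ∀ L : ModuleCat.{u} R, SyzN R n L
        (ModuleCat.of R (M ⧸ (Ideal.ofList (l.take n) • (⊤ : Submodule R M)))) →
        StEq R L (∀ i, K (d i)) := by
  induction n with
  | zero =>
    refine ⟨Unit, inferInstance, fun _ => 0, ?_, ?_⟩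
    · intro k
      cases k with
      | zero => simp
      | succ k => simp
    · rintro L ⟨e⟩
      have h0 : Ideal.ofList (l.take 0) • (⊤ : Submodule R M) = ⊥ := by simp
      exact StEq.of_equiv (e ≪≫ₗ Submodule.quotEquivOfEqBot _ h0 ≪≫ₗ e₀.symm ≪≫ₗ
        (LinearEquiv.funUnique Unit R (K 0)).symm)
  | succ n ih =>
    obtain ⟨I, hI, d, hd, h⟩ := ih (by omega)
    refine ⟨I ⊕ I, inferInstance, Sum.elim d (fun i => d i + 1), card_fiber_sum d n hd, ?_⟩
    have hdn : ∀ i, d i ≤ n := by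
      intro i
      by_contra h
      have h1 := hd (d i)
      rw [Nat.choose_eq_zero_of_lt (by omega)] at h1
      have : Nonempty {j // d j = d i} := ⟨⟨i, rfl⟩⟩
      exact Nat.card_pos.ne' h1
    have hsm : Ideal.ofList (l.take (n+1)) • (⊤ : Submodule R M) =
        Ideal.ofList (l.take n) • ⊤ ⊔ l[n] • (⊤ : Submodule R M) := by
      rw [List.take_succ_eq_append_getElem (by omega), Ideal.ofList_append, Submodule.sup_smul,
        Ideal.ofList_singleton, Submodule.ideal_span_singleton_smul]
    have hle : Ideal.ofList (l.take n) • (⊤ : Submodule R M) ≤ Ideal.ofList (l.take (n+1)) • ⊤ := by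
      rw [hsm]; exact le_sup_left
    have hfin : Module.Finite R (ModuleCat.of R (M ⧸ (Ideal.ofList (l.take n) • (⊤ : Submodule R M)))) :=
      inferInstanceAs (Module.Finite R (M ⧸ (Ideal.ofList (l.take n) • (⊤ : Submodule R M))))
    have := step (N := ModuleCat.of R (M ⧸ (Ideal.ofList (l.take n) • (⊤ : Submodule R M))))
      (N' := ModuleCat.of R (M ⧸ (Ideal.ofList (l.take (n+1)) • (⊤ : Submodule R M))))
      l[n] (hreg.regular_mod_prev n (by omega)) (Submodule.factor hle)
      (Submodule.factor_surjective hle) ?_ n (∀ i, K (d i)) (∀ i, K (d i + 1)) h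
      (Syz.pi _ _ fun i => hsyz _) (SF.pi _ fun i => hSF n (by omega) _ (hdn i))
    · intro L hL
      exact (this L hL).trans (StEq.of_equiv
        (LinearEquiv.sumPiEquivProdPi R I I (fun i => K (Sum.elim d (fun i => d i + 1) i))).symm)
    · intro a
      obtain ⟨a, rfl⟩ := Submodule.mkQ_surjective _ a
      change (Submodule.Quotient.mk a : M ⧸ (Ideal.ofList (l.take (n+1)) • (⊤ : Submodule R M))) = 0 ↔ _
      rw [Submodule.Quotient.mk_eq_zero, hsm, Submodule.mem_sup]
      constructor
      · rintro ⟨y, hy, z, hz, rfl⟩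
        obtain ⟨b, -, rfl⟩ := hz
        refine ⟨Submodule.mkQ _ b, ?_⟩
        rw [map_add, ← map_smul]
        have : (Ideal.ofList (l.take n) • (⊤ : Submodule R M)).mkQ y = 0 := by
          simpa using hy
        rw [this, zero_add]
        rfl
      · rintro ⟨b, hb⟩
        obtain ⟨b, rfl⟩ := Submodule.mkQ_surjective _ b
        rw [← map_smul, ← sub_eq_zero, ← map_sub, Submodule.mkQ_apply,
          Submodule.Quotient.mk_eq_zero] at hb
        exact ⟨_, hb, l[n] • b, ⟨b, trivial, rfl⟩, by simp⟩

theorem syzN_seq {R : Type u} [CommRing R] (N : ModuleCat.{u} R)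
    (K : ℕ → Type u) [∀ i, AddCommGroup (K i)] [∀ i, Module R (K i)]
    (e₀ : K 0 ≃ₗ[R] N) (hsyz : ∀ i, Syz R (K (i + 1)) (K i)) (n : ℕ) :
    SyzN R n (ModuleCat.of R (K n)) N := by
  induction n with
  | zero => exact ⟨e₀⟩
  | succ n ih => exact ⟨_, ih, hsyz n⟩

/-- Let `x₁, …, xₙ` satisfy `x_p · Ext^q_R(M, Ω^r M) = 0` for `1 ≤ q, r ≤ p ≤ n` and form a
regular sequence on `M`. Then any `n`-th syzygy of `M/(x₁,…,xₙ)M` is isomorphic, up to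
finitely generated projective direct summands, to `⊕_{k=0}^{n} (Ω^k M)^{⊕ C(n,k)}`.
Here the syzygies `Ω^k M = K k` are encoded by a projective resolution
`⋯ → P i → ⋯ → P 0 → M` with `K (i+1) = ker (P i → K i)` and `K 0 ≅ M`, and similarly for
`M/(x)M`. -/
theorem stmt14 {R : Type u} [CommRing R] [IsNoetherianRing R]
    (M : Type u) [AddCommGroup M] [Module R M] [Module.Finite R M]
    -- a projective resolution of `M`, with syzygies `K i` (`K 0 ≅ M`)
    (K : ℕ → Type u) [∀ i, AddCommGroup (K i)] [∀ i, Module R (K i)]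
    (P : ℕ → Type u) [∀ i, AddCommGroup (P i)] [∀ i, Module R (P i)]
    (hPproj : ∀ i, Module.Projective R (P i)) (hPfin : ∀ i, Module.Finite R (P i))
    (e₀ : K 0 ≃ₗ[R] M)
    (π : ∀ i, P i →ₗ[R] K i) (hπ : ∀ i, Surjective (π i))
    (ι : ∀ i, K (i + 1) →ₗ[R] P i) (hι : ∀ i, Injective (ι i))
    (hexact : ∀ i, LinearMap.range (ι i) = LinearMap.ker (π i))
    -- the sequence `x`, the Ext-annihilation hypothesis and regularity on `M`
    {n : ℕ} (x : Fin n → R)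
    (hx : ∀ (p : Fin n) (q r : ℕ), 1 ≤ q → q ≤ p.1 + 1 → 1 ≤ r → r ≤ p.1 + 1 →
      ∀ e : ((Ext R (ModuleCat.{u} R) q).obj (op (ModuleCat.of R M))).obj
        (ModuleCat.of R (K r)), (x p) • e = 0)
    (hreg : RingTheory.Sequence.IsRegular M (List.ofFn x)) :
    -- conclusion: for every syzygy sequence of `M/(x)M`, the `n`-th syzygy is
    -- `⊕ (Ω^k M)^{C(n,k)}` up to finitely generated projective summands
    ∀ (K' : ℕ → Type u) [∀ i, AddCommGroup (K' i)] [∀ i, Module R (K' i)]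
      (P' : ℕ → Type u) [∀ i, AddCommGroup (P' i)] [∀ i, Module R (P' i)],
      (∀ i, Module.Projective R (P' i)) → (∀ i, Module.Finite R (P' i)) →
      ∀ (_ : K' 0 ≃ₗ[R] (M ⧸ (Ideal.span (Set.range x) • (⊤ : Submodule R M))))
        (π' : ∀ i, P' i →ₗ[R] K' i), (∀ i, Surjective (π' i)) →
      ∀ (ι' : ∀ i, K' (i + 1) →ₗ[R] P' i), (∀ i, Injective (ι' i)) →
      (∀ i, LinearMap.range (ι' i) = LinearMap.ker (π' i)) →
      ∃ Q₁ Q₂ : ModuleCat.{u} R,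
        Module.Projective R Q₁ ∧ Module.Finite R Q₁ ∧
        Module.Projective R Q₂ ∧ Module.Finite R Q₂ ∧
        Nonempty ((K' n × Q₁) ≃ₗ[R]
          (((k : Fin (n + 1)) → Fin (n.choose k.1) → K k.1) × Q₂)) := by
  have hsyz : ∀ i, Syz R (K (i + 1)) (K i) := fun i =>
    ⟨ModuleCat.of R (P i), π i, ι i, hPproj i, hPfin i, hπ i, hι i, hexact i⟩
  have hSF : ∀ (p : ℕ) (hp : p < (List.ofFn x).length) (k : ℕ), k ≤ p →
      SF R (List.ofFn x)[p] (K k) := by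
    intro p hp k hk
    rw [List.getElem_ofFn]
    obtain ⟨g, hg⟩ := ext_kill M K P π ι hexact hPproj hπ hι e₀ k (x ⟨p, by simpa using hp⟩)
      (hx ⟨p, by simpa using hp⟩ (k+1) (k+1) (by omega) (by simpa using hk) (by omega)
        (by simpa using hk))
    exact ⟨ModuleCat.of R (P k), g, π k, hPproj k, hg⟩
  obtain ⟨I, _, d, hd, h⟩ := main_ind M K e₀ hsyz (List.ofFn x) hreg.toIsWeaklyRegular hSF n
    (by simp)
  intro K' _ _ P' _ _ hP' hPf' e' π' hπ' ι' hι' hex'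
  have hI : Ideal.ofList ((List.ofFn x).take n) = Ideal.span (Set.range x) := by
    rw [List.take_of_length_le (by simp)]
    exact congrArg Ideal.span (Set.ext fun r => List.mem_ofFn)
  rw [hI] at h
  have h1 := h _ (syzN_seq _ K' e' (fun i =>
    ⟨ModuleCat.of R (P' i), π' i, ι' i, hP' i, hPf' i, hπ' i, hι' i, hex' i⟩) n)
  obtain ⟨e⟩ := final_equiv (R := R) K d n hd
  exact h1.trans (StEq.of_equiv e)
end

section
/- Let R be a commutative noetherian local ring with maximal ideal m and residue field k. Then every finitely generated R-module that is locally free on the punctured spectrum belongs to the resolving closure of k in the category of finitely generated R-modules, i.e., to the smallest subcategory containing k and all finitely generated projective modules and closed under direct summands, extensions, and syzygies. -/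
open Function

universe u

/-- Finitely generated modules on which every element of `t` acts nilpotently. -/
def QQ (R : Type u) [CommRing R] (t : Set R) (N : Type u) [AddCommGroup N] [Module R N] : Prop :=
  Module.Finite R N ∧ ∀ y ∈ t, ∃ k : ℕ, ∀ n : N, y ^ k • n = 0

/-- `N` starts a complex `N → F_{n-1} → ... → F_0` with homology in `QQ R t`. -/
def HH (R : Type u) [CommRing R] (t : Set R) :
    ℕ → ∀ (N : Type u) [AddCommGroup N] [Module R N], Prop
  | 0, N, _, _ => QQ R t N
  | n + 1, N, _, _ => ∃ (F : Type u) (_ : AddCommGroup F) (_ : Module R F)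
      (_ : Module.Projective R F) (_ : Module.Finite R F) (f : N →ₗ[R] F),
      QQ R t (LinearMap.ker f) ∧ HH R t n (F ⧸ LinearMap.range f)

/-- Pullback of `π` along multiplication by `x`. -/
abbrev UU {R : Type u} [CommRing R] {N G : Type u} [AddCommGroup N] [Module R N]
    [AddCommGroup G] [Module R G] (x : R) (π : G →ₗ[R] N) : Submodule R (N × G) :=
  LinearMap.ker (x • LinearMap.fst R N G - π ∘ₗ LinearMap.snd R N G)

section
set_option linter.unusedSectionVars false
variable {R : Type u} [CommRing R] [IsNoetherianRing R] {t : Set R}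

lemma UU_mem {N G : Type u} [AddCommGroup N] [Module R N]
    [AddCommGroup G] [Module R G] (x : R) (π : G →ₗ[R] N) (a : N × G) :
    a ∈ UU x π ↔ x • a.1 = π a.2 := by
  simp [sub_eq_zero]

lemma QQ_inj {A B : Type u} [AddCommGroup A] [Module R A] [AddCommGroup B] [Module R B]
    (f : A →ₗ[R] B) (hf : Injective f) (h : QQ R t B) : QQ R t A := by
  obtain ⟨h1, h2⟩ := h
  refine ⟨Module.Finite.of_injective f hf, fun y hy => ?_⟩
  obtain ⟨k, hk⟩ := h2 y hy
  exact ⟨k, fun n => hf (by simp [hk])⟩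

lemma QQ_surj {A B : Type u} [AddCommGroup A] [Module R A] [AddCommGroup B] [Module R B]
    (f : A →ₗ[R] B) (hf : Surjective f) (h : QQ R t A) : QQ R t B := by
  obtain ⟨h1, h2⟩ := h
  refine ⟨Module.Finite.of_surjective f hf, fun y hy => ?_⟩
  obtain ⟨k, hk⟩ := h2 y hy
  refine ⟨k, fun n => ?_⟩
  obtain ⟨a, rfl⟩ := hf n
  rw [← map_smul, hk, map_zero]

lemma QQ_ext {A B : Type u} [AddCommGroup A] [Module R A] [AddCommGroup B] [Module R B]
    (f : A →ₗ[R] B) (h : QQ R t (LinearMap.ker f)) (hB : QQ R t B) : QQ R t A := by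
  obtain ⟨h1, h2⟩ := h
  obtain ⟨h3, h4⟩ := hB
  refine ⟨?_, fun y hy => ?_⟩
  · have hr : (LinearMap.range f).FG := IsNoetherian.noetherian _
    rw [Module.finite_def]
    refine Submodule.fg_of_fg_map_of_fg_inf_ker f ?_ ?_
    · rwa [Submodule.map_top]
    · rw [top_inf_eq]; exact Module.Finite.iff_fg.1 h1
  · obtain ⟨k, hk⟩ := h2 y hy
    obtain ⟨l, hl⟩ := h4 y hy
    refine ⟨k + l, fun n => ?_⟩
    have := hk ⟨y ^ l • n, by simp [hl]⟩
    rw [pow_add, mul_smul]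
    simpa using congrArg Subtype.val this

lemma QQ_insert {A : Type u} [AddCommGroup A] [Module R A] (x : R) (h : QQ R t A)
    (hx : ∀ a : A, x • a = 0) : QQ R (insert x t) A := by
  refine ⟨h.1, fun y hy => ?_⟩
  rcases hy with rfl | hy
  · exact ⟨1, by simpa using hx⟩
  · exact h.2 y hy

lemma HH_surj (n : ℕ) {A B : Type u} [AddCommGroup A] [Module R A] [AddCommGroup B] [Module R B]
    (f : A →ₗ[R] B) (hf : Surjective f) (h : QQ R t (LinearMap.ker f)) (hB : HH R t n B) :
    HH R t n A := by
  cases n with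
  | zero => exact QQ_ext f h hB
  | succ n =>
    obtain ⟨F, _, _, _, _, g, hg, hn⟩ := hB
    refine ⟨F, _, _, ‹_›, ‹_›, g ∘ₗ f, ?_, ?_⟩
    · let φ : LinearMap.ker (g ∘ₗ f) →ₗ[R] LinearMap.ker g :=
        f.restrict (fun a ha => by simpa using ha)
      refine QQ_ext φ ?_ hg
      let ψ : LinearMap.ker φ →ₗ[R] LinearMap.ker f :=
        ((LinearMap.ker (g ∘ₗ f)).subtype ∘ₗ (LinearMap.ker φ).subtype).codRestrict _ (by
          rintro ⟨a, ha⟩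
          exact congrArg Subtype.val ha)
      refine QQ_inj ψ ?_ h
      intro a b hab
      have hab' : a.1.1 = b.1.1 :=
        congrArg (fun w : LinearMap.ker f => (w : A)) hab
      exact Subtype.ext (Subtype.ext hab')
    · rw [LinearMap.range_comp_of_range_eq_top g (LinearMap.range_eq_top.2 hf)]
      exact hn

lemma HH_UU (x : R) (n : ℕ) : ∀ {N G : Type u} [AddCommGroup N] [Module R N]
    [AddCommGroup G] [Module R G] [Module.Projective R G] [Module.Finite R G]
    (π : G →ₗ[R] N) (_ : Surjective π), HH R t n N → HH R (insert x t) (n + 1) (UU x π) := by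
  induction n with
  | zero =>
    intro N G _ _ _ _ _ _ π hπ h
    refine ⟨G, _, _, ‹_›, ‹_›, LinearMap.snd R N G ∘ₗ (UU x π).subtype, ?_, ?_⟩
    · apply QQ_insert
      · let ψ : LinearMap.ker (LinearMap.snd R N G ∘ₗ (UU x π).subtype) →ₗ[R] N :=
          LinearMap.fst R N G ∘ₗ (UU x π).subtype ∘ₗ Submodule.subtype _
        refine QQ_inj ψ ?_ h
        rintro ⟨⟨⟨a, b⟩, h1⟩, h2⟩ ⟨⟨⟨a', b'⟩, h1'⟩, h2'⟩ hab
        simp only [LinearMap.mem_ker, LinearMap.comp_apply, Submodule.subtype_apply,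
          LinearMap.snd_apply] at h2 h2'
        have : a = a' := hab
        subst h2 h2' this
        rfl
      · rintro ⟨⟨⟨a, b⟩, h1⟩, h2⟩
        simp only [LinearMap.mem_ker, LinearMap.comp_apply, Submodule.subtype_apply,
          LinearMap.snd_apply] at h2
        rw [UU_mem] at h1
        subst h2
        refine Subtype.ext (Subtype.ext (Prod.ext ?_ ?_))
        · simpa using h1
        · simp
    · change QQ R (insert x t) _
      -- the quotient embeds in `N / xN`
      let L : Submodule R N := LinearMap.range (x • (LinearMap.id : N →ₗ[R] N))
      have hL : QQ R (insert x t) (N ⧸ L) := by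
        apply QQ_insert x (QQ_surj L.mkQ L.mkQ_surjective h)
        intro a
        obtain ⟨a, rfl⟩ := L.mkQ_surjective a
        rw [← map_smul]
        simp only [Submodule.mkQ_apply]
        rw [Submodule.Quotient.mk_eq_zero]
        exact ⟨a, rfl⟩
      have hle : ∀ g : G, g ∈ LinearMap.range (LinearMap.snd R N G ∘ₗ (UU x π).subtype) ↔
          (L.mkQ ∘ₗ π) g = 0 := by
        intro g
        simp only [LinearMap.comp_apply, Submodule.mkQ_apply]
        rw [Submodule.Quotient.mk_eq_zero]
        constructor
        · rintro ⟨⟨⟨a, b⟩, h1⟩, rfl⟩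
          rw [UU_mem] at h1
          exact ⟨a, h1⟩
        · rintro ⟨a, ha⟩
          exact ⟨⟨(a, g), (UU_mem _ _ _).2 ha⟩, rfl⟩
      have heq : LinearMap.range (LinearMap.snd R N G ∘ₗ (UU x π).subtype) =
          LinearMap.ker (L.mkQ ∘ₗ π) := by
        ext g; rw [hle, LinearMap.mem_ker]
      rw [heq]
      exact QQ_inj _ (LinearMap.ker_eq_bot.1 (Submodule.ker_liftQ_eq_bot' _ _ rfl)) hL
  | succ n ih =>
    intro N G _ _ _ _ _ _ π hπ h
    obtain ⟨F, _, _, _, _, f, hK, hn⟩ := h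
    have ihC := ih (LinearMap.range f).mkQ (LinearMap.range f).mkQ_surjective hn
    let ρ : UU x π →ₗ[R] G × F :=
      ((LinearMap.snd R N G).prod (f ∘ₗ LinearMap.fst R N G)) ∘ₗ (UU x π).subtype
    refine ⟨G × F, _, _, inferInstance, inferInstance, ρ, ?_, ?_⟩
    · apply QQ_insert
      · let ψ : LinearMap.ker ρ →ₗ[R] LinearMap.ker f :=
          (LinearMap.fst R N G ∘ₗ (UU x π).subtype ∘ₗ Submodule.subtype _).codRestrict _ (by
            rintro ⟨⟨⟨a, b⟩, h1⟩, h2⟩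
            exact congrArg Prod.snd h2)
        refine QQ_inj ψ ?_ hK
        rintro ⟨⟨⟨a, b⟩, h1⟩, h2⟩ ⟨⟨⟨a', b'⟩, h1'⟩, h2'⟩ hab
        have e1 : b = 0 := congrArg Prod.fst h2
        have e2 : b' = 0 := congrArg Prod.fst h2'
        have : a = a' := congrArg Subtype.val hab
        subst e1 e2 this
        rfl
      · rintro ⟨⟨⟨a, b⟩, h1⟩, h2⟩
        have e1 : b = 0 := congrArg Prod.fst h2
        rw [UU_mem] at h1
        subst e1
        refine Subtype.ext (Subtype.ext (Prod.ext ?_ ?_))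
        · simpa using h1
        · simp
    · let C := F ⧸ LinearMap.range f
      let q : F →ₗ[R] C := (LinearMap.range f).mkQ
      have hqf : ∀ a, q (f a) = 0 := fun a => by
        exact (Submodule.Quotient.mk_eq_zero _).2 ⟨a, rfl⟩
      let θ0 : G × F →ₗ[R] UU x q :=
        ((q ∘ₗ LinearMap.snd R G F).prod
          (x • LinearMap.snd R G F - f ∘ₗ π ∘ₗ LinearMap.fst R G F)).codRestrict _ (by
            rintro ⟨g, p⟩
            rw [UU_mem]
            simp [hqf])
      have hθρ : LinearMap.range ρ ≤ LinearMap.ker θ0 := by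
        rintro _ ⟨⟨⟨a, b⟩, h1⟩, rfl⟩
        rw [UU_mem] at h1
        simp only at h1
        refine Subtype.ext (Prod.ext ?_ ?_)
        · exact hqf a
        · change x • f a - f (π b) = 0
          rw [← h1, map_smul, sub_self]
      let θ := (LinearMap.range ρ).liftQ θ0 hθρ
      have hθ : Surjective θ := by
        rintro ⟨⟨c, p'⟩, h1⟩
        rw [UU_mem] at h1
        obtain ⟨p, rfl⟩ := (LinearMap.range f).mkQ_surjective c
        have h2 : x • p - p' ∈ LinearMap.range f := by
          rw [← Submodule.Quotient.mk_eq_zero]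
          change q (x • p - p') = 0
          rw [map_sub, map_smul, sub_eq_zero]; exact h1
        obtain ⟨a, ha⟩ := h2
        obtain ⟨g, rfl⟩ := hπ a
        refine ⟨Submodule.Quotient.mk (g, p), Subtype.ext (Prod.ext rfl ?_)⟩
        change x • p - f (π g) = p'
        rw [ha]; abel
      refine HH_surj (n + 1) θ hθ ?_ ihC
      -- a presentation of the kernel of `θ` as a quotient of a submodule related to `K`
      have hel : ∀ z : LinearMap.ker θ, ∃ (a : N) (g : G), x • a - π g ∈ LinearMap.ker f ∧
          (LinearMap.range ρ).mkQ (g, f a) = z.1 := by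
        rintro ⟨z, hz⟩
        obtain ⟨⟨g, p⟩, rfl⟩ := (LinearMap.range ρ).mkQ_surjective z
        have hz' : θ0 (g, p) = 0 := hz
        have e1 : q p = 0 := congrArg (fun w => w.1.1) hz'
        have e2 : x • p - f (π g) = 0 := congrArg (fun w => w.1.2) hz'
        have e3 : p ∈ LinearMap.range f := by
          rw [← Submodule.Quotient.mk_eq_zero]; exact e1
        obtain ⟨a, rfl⟩ := e3
        refine ⟨a, g, ?_, rfl⟩
        rw [LinearMap.mem_ker, map_sub, map_smul, e2]
      have hann : ∀ (r : R) (a : N) (g : G), (∃ b : N, r • (x • a - π g) = x • b ∧ f b = 0) →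
          r • (LinearMap.range ρ).mkQ (g, f a) = 0 := by
        rintro r a g ⟨b, hb, hfb⟩
        rw [← map_smul, Submodule.mkQ_apply, Submodule.Quotient.mk_eq_zero]
        refine ⟨⟨(r • a - b, r • g), (UU_mem _ _ _).2 ?_⟩, ?_⟩
        · simp only [map_smul]
          rw [smul_sub, ← hb, smul_sub, smul_comm]; abel
        · refine Prod.ext rfl ?_
          change f (r • a - b) = r • f a
          rw [map_sub, hfb, sub_zero, map_smul]
      refine ⟨inferInstance, ?_⟩
      rintro y (rfl | hy)
      · refine ⟨1, fun z => ?_⟩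
        obtain ⟨a, g, h1, h2⟩ := hel z
        refine Subtype.ext ?_
        change y ^ 1 • z.1 = 0
        rw [← h2, pow_one]
        exact hann y a g ⟨_, rfl, h1⟩
      · obtain ⟨k, hk⟩ := hK.2 y hy
        refine ⟨k, fun z => ?_⟩
        obtain ⟨a, g, h1, h2⟩ := hel z
        refine Subtype.ext ?_
        change y ^ k • z.1 = 0
        rw [← h2]
        refine hann _ a g ⟨0, ?_, map_zero f⟩
        rw [smul_zero]
        exact congrArg Subtype.val (hk ⟨_, h1⟩)

/-- elements whose multiplication on `M` factors through a f.g. projective module -/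
def Fac {R : Type u} [CommRing R] (M : Type u) [AddCommGroup M] [Module R M]
    {F : Type u} [AddCommGroup F] [Module R F] (π : F →ₗ[R] M) : Ideal R where
  carrier := {x | ∃ β : M →ₗ[R] F, π ∘ₗ β = x • LinearMap.id}
  zero_mem' := ⟨0, by simp⟩
  add_mem' := by
    rintro a b ⟨f, hf⟩ ⟨g, hg⟩
    exact ⟨f + g, by rw [LinearMap.comp_add, hf, hg, add_smul]⟩
  smul_mem' := by
    rintro c a ⟨f, hf⟩
    exact ⟨c • f, by rw [LinearMap.comp_smul, hf, smul_assoc]⟩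

lemma HH_finite (n : ℕ) (N : Type u) [AddCommGroup N] [Module R N] (h : HH R t n N) :
    Module.Finite R N := by
  cases n with
  | zero => exact h.1
  | succ n =>
    obtain ⟨F, _, _, _, _, f, hK, hn⟩ := h
    have h1 := hK.1
    have hr : (LinearMap.range f).FG := IsNoetherian.noetherian _
    rw [Module.finite_def]
    refine Submodule.fg_of_fg_map_of_fg_inf_ker f ?_ ?_
    · rwa [Submodule.map_top]
    · rw [top_inf_eq]; exact Module.Finite.iff_fg.1 h1

lemma exists_HH (M : Type u) [AddCommGroup M] [Module R M] [Module.Finite R M]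
    {F : Type u} [AddCommGroup F] [Module R F] [Module.Projective R F] (π : F →ₗ[R] M)
    (t : Set R) (ht : t.Finite) : t ⊆ Fac M π →
    ∃ (n : ℕ) (W : Type u) (_ : AddCommGroup W) (_ : Module R W) (i : M →ₗ[R] W)
      (r : W →ₗ[R] M), r ∘ₗ i = LinearMap.id ∧ HH R t n W := by
  induction t, ht using Set.Finite.induction_on with
  | empty =>
    intro _
    exact ⟨0, M, _, _, LinearMap.id, LinearMap.id, rfl, ‹_›, fun y hy => hy.elim⟩
  | @insert x t _ _ ih =>
    intro hsub
    obtain ⟨n, W, _, _, i, r, hri, hW⟩ := ih (fun y hy => hsub (Or.inr hy))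
    obtain ⟨β, hβ⟩ := hsub (Or.inl rfl)
    have := HH_finite n W hW
    obtain ⟨m, σ, hσ⟩ := Module.Finite.exists_fin' R W
    obtain ⟨δ, hδ⟩ := Module.projective_lifting_property σ (i ∘ₗ π) hσ
    refine ⟨n + 1, UU x σ, inferInstance, inferInstance,
      (i.prod (δ ∘ₗ β)).codRestrict _ ?_, r ∘ₗ LinearMap.fst R _ _ ∘ₗ (UU x σ).subtype, ?_, ?_⟩
    · intro a
      rw [UU_mem]
      have h1 : σ (δ (β a)) = i (π (β a)) := LinearMap.congr_fun hδ (β a)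
      have h2 : π (β a) = x • a := LinearMap.congr_fun hβ a
      change x • i a = σ (δ (β a))
      rw [h1, h2, map_smul]
    · ext a
      exact LinearMap.congr_fun hri a
    · exact HH_UU x n σ hσ hW

lemma Fac_not_le (M : Type u) [AddCommGroup M] [Module R M] [Module.Finite R M]
    {F : Type u} [AddCommGroup F] [Module R F] [Module.Finite R F] (π : F →ₗ[R] M)
    (hπ : Surjective π) (p : Ideal R) [p.IsPrime]
    (h : Module.Free (Localization.AtPrime p) (LocalizedModule p.primeCompl M)) :
    ¬ Fac M π ≤ p := by
  intro hle
  let S := p.primeCompl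
  let mM := LocalizedModule.mkLinearMap S M
  let mF := LocalizedModule.mkLinearMap S F
  let πp := IsLocalizedModule.mapExtendScalars S mF mM (Localization.AtPrime p) π
  have hs : Surjective πp := IsLocalizedModule.map_surjective S mF mM π hπ
  obtain ⟨σ, hσ⟩ := Module.projective_lifting_property πp LinearMap.id hs
  have := Module.finitePresentation_of_finite R M
  have := Module.finitePresentation_of_finite R F
  obtain ⟨h, s, hh⟩ := Module.FinitePresentation.exists_lift_of_isLocalizedModule S mF
    ((σ.restrictScalars R) ∘ₗ mM)
  have e : mM ∘ₗ (π ∘ₗ h) = mM ∘ₗ (s.1 • LinearMap.id) := by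
    ext a
    have h1 : mF (h a) = s.1 • σ (mM a) := LinearMap.congr_fun hh a
    have h2 : πp (mF (h a)) = mM (π (h a)) := IsLocalizedModule.map_apply S mF mM π (h a)
    have h3 : πp (σ (mM a)) = mM a := LinearMap.congr_fun hσ (mM a)
    change mM (π (h a)) = mM (s.1 • a)
    rw [← h2, h1, map_smul mM]
    have : πp (s.1 • σ (mM a)) = s.1 • πp (σ (mM a)) := (πp.restrictScalars R).map_smul _ _
    rw [this, h3]
  obtain ⟨u, hu⟩ := Module.Finite.exists_smul_of_comp_eq_of_isLocalizedModule S mM _ _ e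
  have hmem : u.1 * s.1 ∈ Fac M π := by
    refine ⟨u.1 • h, ?_⟩
    rw [LinearMap.comp_smul, mul_smul]
    exact hu
  exact (u * s).2 (hle hmem)

end

/-- Over a noetherian local ring `(R, m, k)`, every finitely generated module that is
locally free on the punctured spectrum belongs to the resolving closure of `k`: every
class of modules that contains `k` and the finitely generated projectives, respects
isomorphisms, and is closed under direct summands, extensions and syzygies, contains it. -/
theorem stmt16 {R : Type u} [CommRing R] [IsNoetherianRing R] [IsLocalRing R]
    (P : ∀ (N : Type u) [AddCommGroup N] [Module R N], Prop)
    (hiso : ∀ (N N' : Type u) [AddCommGroup N] [Module R N] [AddCommGroup N'] [Module R N'],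
      (N ≃ₗ[R] N') → P N → P N')
    (hk : P (R ⧸ IsLocalRing.maximalIdeal R))
    (hproj : ∀ (Q : Type u) [AddCommGroup Q] [Module R Q],
      Module.Projective R Q → Module.Finite R Q → P Q)
    (hsummand : ∀ (N N' : Type u) [AddCommGroup N] [Module R N] [AddCommGroup N'] [Module R N'],
      P (N × N') → P N)
    (hext : ∀ (A B C : Type u) [AddCommGroup A] [Module R A] [AddCommGroup B] [Module R B]
        [AddCommGroup C] [Module R C],
      ∀ (f : A →ₗ[R] B) (g : B →ₗ[R] C),
        Injective f → Surjective g → LinearMap.range f = LinearMap.ker g →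
        P A → P C → P B)
    (hsyz : ∀ (S Q N : Type u) [AddCommGroup S] [Module R S] [AddCommGroup Q] [Module R Q]
        [AddCommGroup N] [Module R N],
      Module.Projective R Q → Module.Finite R Q →
      ∀ (ι : S →ₗ[R] Q) (ρ : Q →ₗ[R] N),
        Injective ι → Surjective ρ → LinearMap.range ι = LinearMap.ker ρ →
        P N → P S)
    (M : Type u) [AddCommGroup M] [Module R M] [Module.Finite R M]
    (hM : ∀ p : PrimeSpectrum R, p.asIdeal ≠ IsLocalRing.maximalIdeal R →
      Module.Free (Localization.AtPrime p.asIdeal) (LocalizedModule p.asIdeal.primeCompl M)) :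
    P M := by
  obtain ⟨m, π, hπ⟩ := Module.Finite.exists_fin' R M
  obtain ⟨t, ht⟩ := (IsNoetherian.noetherian (Fac M π) : (Fac M π).FG)
  obtain ⟨n, W, _, _, i, r, hri, hW⟩ := exists_HH M π (t : Set R) t.finite_toSet
    (by rw [← ht]; exact Submodule.subset_span)
  have hQ : ∀ (N : Type u) [AddCommGroup N] [Module R N], QQ R (t : Set R) N → P N := by
    intro N _ _ hN
    have hfin := hN.1
    revert hN
    induction hfin using IsNoetherianRing.induction_on_isQuotientEquivQuotientPrime R with
    | subsingleton N => exact fun _ => hproj N inferInstance inferInstance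
    | quotient N p e =>
      intro hN
      have hp : p.asIdeal = IsLocalRing.maximalIdeal R := by
        by_contra hne
        refine Fac_not_le M π hπ p.asIdeal (hM p hne) ?_
        rw [← ht, Submodule.span_le]
        intro y hy
        obtain ⟨k, hk⟩ := hN.2 y hy
        have h1 := congrArg e (hk (e.symm 1))
        rw [map_smul, e.apply_symm_apply, map_zero, Algebra.smul_def, mul_one] at h1
        exact p.2.mem_of_pow_mem k (Ideal.Quotient.eq_zero_iff_mem.1 h1)
      rw [hp] at e
      exact hiso _ _ e.symm hk
    | exact N₁ N₂ N₃ f g hf hg hfg h1 h3 =>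
      intro hN
      exact hext N₁ N₂ N₃ f g hf hg (LinearMap.exact_iff.1 hfg).symm
        (h1 (QQ_inj f hf hN)) (h3 (QQ_surj g hg hN))
  have hH : ∀ (n : ℕ) (N : Type u) [AddCommGroup N] [Module R N],
      HH R (t : Set R) n N → P N := by
    intro n
    induction n with
    | zero => exact fun N _ _ h => hQ N h
    | succ n ih =>
      intro N _ _ h
      obtain ⟨F, _, _, _, _, f, hK, hn⟩ := h
      refine hext (LinearMap.ker f) N (LinearMap.range f) (LinearMap.ker f).subtype f.rangeRestrict
        Subtype.val_injective f.surjective_rangeRestrict ?_ (hQ _ hK) ?_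
      · rw [Submodule.range_subtype, LinearMap.ker_rangeRestrict]
      · exact hsyz (LinearMap.range f) F (F ⧸ LinearMap.range f) inferInstance inferInstance
          (LinearMap.range f).subtype (LinearMap.range f).mkQ Subtype.val_injective
          (Submodule.mkQ_surjective _) (by rw [Submodule.range_subtype, Submodule.ker_mkQ])
          (ih _ hn)
  have hPW := hH n W hW
  -- `W ≃ M × ker r`
  let φ : (M × LinearMap.ker r) →ₗ[R] W := i.coprod (LinearMap.ker r).subtype
  have hri' : ∀ a, r (i a) = a := fun a => LinearMap.congr_fun hri a
  have hφ : Bijective φ := by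
    constructor
    · rw [← LinearMap.ker_eq_bot, LinearMap.ker_eq_bot']
      rintro ⟨a, b, hb⟩ h
      have h' : i a + b = 0 := h
      have ha : a = 0 := by
        have := congrArg r h'
        rwa [map_add, hri', LinearMap.mem_ker.1 hb, add_zero, map_zero] at this
      subst ha
      have hb0 : b = 0 := by simpa using h'
      subst hb0
      rfl
    · intro w
      refine ⟨(r w, ⟨w - i (r w), by simp [hri']⟩), ?_⟩
      change i (r w) + (w - i (r w)) = w
      abel
  exact hsummand M (LinearMap.ker r) (hiso _ _ (LinearEquiv.ofBijective φ hφ).symm hPW)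
end

section
/- Let R be a commutative noetherian ring and p a prime ideal such that R_p is not a regular local ring. Then the R_p-module (R/p)_p = R_p/pR_p, i.e., the residue field of R_p, has infinite projective dimension over R_p. -/
open CategoryTheory Opposite

universe u


lemma L0 {A : Type u} [CommRing A] (X : ModuleCat.{u} A) (n : ℕ)
    (h : ∀ i : ℕ, n < i → ∀ N : ModuleCat.{u} A,
      Subsingleton (((Ext A (ModuleCat.{u} A) i).obj (op X)).obj N)) :
    HasProjectiveDimensionLE X n := by
  apply HasProjectiveDimensionLT.mk
  intro i hi Y e
  obtain ⟨j, rfl⟩ : ∃ j, i = j + 1 := ⟨i - 1, by omega⟩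
  let P := ProjectiveResolution.of X
  obtain ⟨f, hf, rfl⟩ := P.extMk_surjective e (j + 2) rfl
  rw [P.extMk_eq_zero_iff f (j + 2) rfl hf j rfl]
  have hs := h (j + 1) (by omega) Y
  have hz : Limits.IsZero ((P.complex.linearYonedaObj A Y).homology (j + 1)) :=
    Limits.IsZero.of_iso (ModuleCat.isZero_of_subsingleton _) (P.isoExt (j + 1) Y).symm
  rw [← HomologicalComplex.exactAt_iff_isZero_homology,
    HomologicalComplex.exactAt_iff' _ j (j + 1) (j + 2) (by simp) (by simp),
    ShortComplex.moduleCat_exact_iff] at hz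
  obtain ⟨g, hg⟩ := hz f hf
  exact ⟨g, hg⟩

lemma L1 {A : Type u} [CommRing A] [IsLocalRing A] [IsNoetherianRing A] (s : A) (hs : s ≠ 0)
    (hsm : ∀ a ∈ IsLocalRing.maximalIdeal A, s * a = 0) (n : ℕ) (M : Type u) [AddCommGroup M]
    [Module A M] [Module.Finite A M] (h : HasProjectiveDimensionLE (ModuleCat.of A M) n) :
    Module.Free A M := by
  induction n generalizing M with
  | zero =>
    have : Module.Projective A M := by
      simp only [HasProjectiveDimensionLE, zero_add] at h
      rwa [← projective_iff_hasProjectiveDimensionLT_one, ← IsProjective.iff_projective] at h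
    exact Module.free_of_flat_of_isLocalRing
  | succ n ih =>
    obtain ⟨r, f, hf⟩ := Module.Finite.exists_fin' A M
    have S_exact := LinearMap.shortExact_shortComplexKer hf
    have proj : Projective (ModuleCat.of A (Fin r → A)) :=
      ModuleCat.projective_of_categoryTheory_projective (ModuleCat.of A (Fin r → A))
    have hK : Module.Free A (LinearMap.ker f) :=
      ih _ ((S_exact.hasProjectiveDimensionLT_X₃_iff n proj).mp h)
    have hmod : Module.FinitePresentation A M := Module.finitePresentation_of_finite A M
    refine Module.free_of_lTensor_residueField_injective (LinearMap.ker f).subtype f hf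
      (LinearMap.exact_subtype_ker_map f) ?_
    rw [injective_iff_map_eq_zero]
    intro t ht
    obtain ⟨v, rfl⟩ : ∃ v, t = (1 : IsLocalRing.ResidueField A) ⊗ₜ[A] v := by
      obtain ⟨v, hv⟩ := TensorProduct.mk_surjective A (LinearMap.ker f)
        (IsLocalRing.ResidueField A) IsLocalRing.residue_surjective t
      exact ⟨v, hv.symm⟩
    have key : ∀ (N : Type u) [AddCommGroup N] [Module A N] (w : N),
        (1 : IsLocalRing.ResidueField A) ⊗ₜ[A] w = 0 ↔
          w ∈ IsLocalRing.maximalIdeal A • (⊤ : Submodule A N) := by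
      intro N _ _ w
      have h0 := TensorProduct.quotTensorEquivQuotSMul_mk_tmul (M := N)
        (IsLocalRing.maximalIdeal A) 1 w
      have h3 : (1 : A ⧸ IsLocalRing.maximalIdeal A) ⊗ₜ[A] w = 0 ↔
          w ∈ IsLocalRing.maximalIdeal A • (⊤ : Submodule A N) := by
        rw [← LinearEquiv.map_eq_zero_iff
          (TensorProduct.quotTensorEquivQuotSMul N (IsLocalRing.maximalIdeal A)),
          ← map_one (Ideal.Quotient.mk (IsLocalRing.maximalIdeal A)), h0, one_smul,
          Submodule.Quotient.mk_eq_zero]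
      exact h3
    rw [LinearMap.lTensor_tmul, key] at ht
    rw [key]
    have h1 : s • (v : Fin r → A) = 0 := by
      change s • (LinearMap.ker f).subtype v = 0
      refine Submodule.smul_induction_on (p := fun w => s • w = 0) ht ?_ ?_
      · intro a ha m _
        rw [smul_smul, hsm a ha, zero_smul]
      · intro x y hx hy
        rw [smul_add, hx, hy, add_zero]
    have h2 : s • v = 0 := Subtype.ext h1
    let b := Module.Free.chooseBasis A (LinearMap.ker f)
    rw [← b.linearCombination_repr v, Finsupp.linearCombination_apply]
    refine Submodule.sum_mem _ fun i _ => Submodule.smul_mem_smul ?_ trivial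
    rw [IsLocalRing.mem_maximalIdeal, mem_nonunits_iff]
    intro hu
    apply hs
    have : s * b.repr v i = 0 := by
      have := congrArg (fun w => b.repr w i) h2
      simpa using this
    exact hu.mul_left_eq_zero.mp this

lemma qmap_aux {A : Type u} [CommRing A] (x : A) {M N : Type u} [AddCommGroup M] [AddCommGroup N]
    [Module A M] [Module A N] (g : M →ₗ[A] N) : Ideal.span {x} • (⊤ : Submodule A M) ≤
        (Ideal.span {x} • (⊤ : Submodule A N)).comap g := by
  rw [← Submodule.map_le_iff_le_comap, Submodule.map_smul'']
  exact smul_mono_right _ le_top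

noncomputable def qmap {A : Type u} [CommRing A] (x : A) {M N : Type u} [AddCommGroup M]
    [AddCommGroup N] [Module A M] [Module A N] (g : M →ₗ[A] N) :
    (M ⧸ Ideal.span {x} • (⊤ : Submodule A M)) →ₗ[A ⧸ Ideal.span {x}]
        (N ⧸ Ideal.span {x} • (⊤ : Submodule A N)) :=
  (Submodule.mapQ _ _ g (qmap_aux x g)).extendScalarsOfSurjective Ideal.Quotient.mk_surjective

lemma L2 {A : Type u} [CommRing A] (x : A) (hx : IsSMulRegular A x) (n : ℕ) (M : Type u)
    [AddCommGroup M] [Module A M] (hxM : IsSMulRegular M x)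
    (h : HasProjectiveDimensionLE (ModuleCat.of A M) n) :
    HasProjectiveDimensionLE (ModuleCat.of (A ⧸ Ideal.span {x})
      (M ⧸ Ideal.span {x} • (⊤ : Submodule A M))) n := by
  have pr : ∀ (P : Type u) [AddCommGroup P] [Module A P] [Module.Projective A P],
      Module.Projective (A ⧸ Ideal.span {x}) (P ⧸ Ideal.span {x} • (⊤ : Submodule A P)) := by
    intro P _ _ _
    let e := TensorProduct.quotTensorEquivQuotSMul P (Ideal.span {x})
    let e' : TensorProduct A (A ⧸ Ideal.span {x}) P ≃ₗ[A ⧸ Ideal.span {x}]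
        (P ⧸ Ideal.span {x} • (⊤ : Submodule A P)) :=
      e.extendScalarsOfSurjective Ideal.Quotient.mk_surjective
    exact Module.Projective.of_equiv e'
  induction n generalizing M with
  | zero =>
    simp only [HasProjectiveDimensionLE, zero_add] at h ⊢
    rw [← projective_iff_hasProjectiveDimensionLT_one, ← IsProjective.iff_projective] at h ⊢
    exact pr M
  | succ n ih =>
    let P := M →₀ A
    let f : P →ₗ[A] M := Finsupp.linearCombination A id
    have hf : Function.Surjective f := Finsupp.linearCombination_id_surjective A M
    let K := LinearMap.ker f
    have S_exact := LinearMap.shortExact_shortComplexKer hf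
    have proj : Projective (ModuleCat.of A P) :=
      ModuleCat.projective_of_categoryTheory_projective (ModuleCat.of A P)
    have hK := (S_exact.hasProjectiveDimensionLT_X₃_iff n proj).mp h
    have hxP : IsSMulRegular P x := by
      intro a b hab
      ext m
      exact hx (DFunLike.congr_fun hab m)
    have hxK : IsSMulRegular K x := hxP.submodule K x
    have hK' := ih K hxK hK
    let B := A ⧸ Ideal.span {x}
    let S : ShortComplex (ModuleCat.{u} B) := ShortComplex.mk
      (ModuleCat.ofHom (qmap x (M := K) (N := P) K.subtype)) (ModuleCat.ofHom (qmap x (M := P) (N := M) f)) (by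
        refine ModuleCat.hom_ext (LinearMap.ext fun y => ?_)
        obtain ⟨y, rfl⟩ := Submodule.Quotient.mk_surjective _ y
        change Submodule.Quotient.mk (f y.1) = 0
        rw [show f y.1 = 0 from y.2]; rfl)
    have hm : ∀ {N : Type u} [AddCommGroup N] [Module A N] (y : N),
        y ∈ Ideal.span {x} • (⊤ : Submodule A N) ↔ ∃ z, x • z = y := by
      intro N _ _ y
      simp [Submodule.ideal_span_singleton_smul, Submodule.mem_smul_pointwise_iff_exists]
    have hS : S.ShortExact := by
      have h1 : Mono S.f := by
        rw [ModuleCat.mono_iff_injective, injective_iff_map_eq_zero]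
        intro y hy
        obtain ⟨y, rfl⟩ := Submodule.Quotient.mk_surjective _ y
        change Submodule.Quotient.mk y.1 = 0 at hy
        rw [Submodule.Quotient.mk_eq_zero, hm] at hy
        refine (Submodule.Quotient.mk_eq_zero _).mpr ((hm (N := K) y).mpr ?_)
        obtain ⟨z, hz⟩ := hy
        refine ⟨⟨z, ?_⟩, Subtype.ext hz⟩
        apply hxM
        change x • f z = x • 0
        rw [← map_smul, hz, smul_zero]
        exact y.2
      have h2 : Epi S.g := by
        rw [ModuleCat.epi_iff_surjective]
        intro y
        obtain ⟨y, rfl⟩ := Submodule.Quotient.mk_surjective _ y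
        obtain ⟨z, rfl⟩ := hf y
        exact ⟨Submodule.Quotient.mk z, rfl⟩
      refine { exact := ?_ }
      rw [ShortComplex.moduleCat_exact_iff]
      intro y hy
      obtain ⟨y, rfl⟩ := Submodule.Quotient.mk_surjective _ y
      change Submodule.Quotient.mk (f y) = 0 at hy
      rw [Submodule.Quotient.mk_eq_zero, hm] at hy
      obtain ⟨z, hz⟩ := hy
      obtain ⟨z, rfl⟩ := hf z
      refine ⟨Submodule.Quotient.mk ⟨y - x • z, ?_⟩, ?_⟩
      · simp [K, hz]
      · change Submodule.Quotient.mk (y - x • z) = Submodule.Quotient.mk y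
        rw [Submodule.Quotient.eq, hm]
        exact ⟨-z, by simp⟩
    have proj' : Projective S.X₂ := by
      rw [← IsProjective.iff_projective]
      exact pr P
    exact (hS.hasProjectiveDimensionLT_X₃_iff n proj').mpr hK'
lemma L3 {B : Type u} [CommRing B] [IsLocalRing B] (N : Type u) [AddCommGroup N] [Module B N]
    (y : N) (hy : ∀ b ∈ IsLocalRing.maximalIdeal B, b • y = 0)
    (hy' : y ∉ IsLocalRing.maximalIdeal B • (⊤ : Submodule B N)) (n : ℕ)
    (h : HasProjectiveDimensionLE (ModuleCat.of B N) n) :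
    HasProjectiveDimensionLE (ModuleCat.of B (IsLocalRing.ResidueField B)) n := by
  let k := B ⧸ IsLocalRing.maximalIdeal B
  let _ : Field k := Ideal.Quotient.field _
  let V := N ⧸ IsLocalRing.maximalIdeal B • (⊤ : Submodule B N)
  have hv : (Submodule.Quotient.mk y : V) ≠ 0 := by
    rwa [Ne, Submodule.Quotient.mk_eq_zero]
  obtain ⟨φ, hφ⟩ := Module.Projective.exists_dual_ne_zero k hv
  let ψ : V →ₗ[k] k := (φ (Submodule.Quotient.mk y))⁻¹ • φ
  have hψ : ψ (Submodule.Quotient.mk y) = 1 := inv_mul_cancel₀ hφ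
  let r : N →ₗ[B] k := (ψ.restrictScalars B) ∘ₗ Submodule.mkQ _
  let i : k →ₗ[B] N := Submodule.liftQ (IsLocalRing.maximalIdeal B)
    (LinearMap.toSpanSingleton B N y) (fun b hb => by simpa using hy b hb)
  have hri : r ∘ₗ i = LinearMap.id := by
    refine LinearMap.ext fun b => ?_
    obtain ⟨b, rfl⟩ := Submodule.Quotient.mk_surjective _ b
    change r (b • y) = _
    rw [map_smul]
    change b • ψ (Submodule.Quotient.mk y) = _
    rw [hψ, Algebra.smul_def, mul_one]
    rfl
  let ret : Retract (ModuleCat.of B k) (ModuleCat.of B N) :=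
    { i := ModuleCat.ofHom i
      r := ModuleCat.ofHom r
      retract := by rw [← ModuleCat.ofHom_comp, hri]; rfl }
  exact ret.hasProjectiveDimensionLT (n + 1)

lemma L3' {A : Type u} [CommRing A] [IsLocalRing A] (n : ℕ)
    (h : HasProjectiveDimensionLE (ModuleCat.of A (IsLocalRing.ResidueField A)) (n + 1)) :
    HasProjectiveDimensionLE (ModuleCat.of A (IsLocalRing.maximalIdeal A)) n := by
  let f : A →ₗ[A] IsLocalRing.ResidueField A := Algebra.linearMap _ _
  have hf : Function.Surjective f := IsLocalRing.residue_surjective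
  have hk : LinearMap.ker f = IsLocalRing.maximalIdeal A := by
    ext a
    exact IsLocalRing.residue_eq_zero_iff a
  have S_exact := LinearMap.shortExact_shortComplexKer hf
  have proj : Projective (ModuleCat.of A A) :=
    ModuleCat.projective_of_categoryTheory_projective (ModuleCat.of A A)
  have hK := (S_exact.hasProjectiveDimensionLT_X₃_iff n proj).mp h
  rwa [← hk]

lemma L3'' {A : Type u} [CommRing A] [IsLocalRing A] (x : A)
    (hxm : x ∈ IsLocalRing.maximalIdeal A) (hx2 : x ∉ IsLocalRing.maximalIdeal A ^ 2)
    [IsLocalRing (A ⧸ Ideal.span {x})] :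
    (Submodule.Quotient.mk ⟨x, hxm⟩ : IsLocalRing.maximalIdeal A ⧸
      Ideal.span {x} • (⊤ : Submodule A (IsLocalRing.maximalIdeal A))) ∉
      IsLocalRing.maximalIdeal (A ⧸ Ideal.span {x}) •
        (⊤ : Submodule (A ⧸ Ideal.span {x}) (IsLocalRing.maximalIdeal A ⧸
      Ideal.span {x} • (⊤ : Submodule A (IsLocalRing.maximalIdeal A)))) := by
  set m := IsLocalRing.maximalIdeal A with hm
  intro hmem
  let g : m →ₗ[A] A ⧸ m ^ 2 := (Submodule.mkQ (m ^ 2)) ∘ₗ m.subtype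
  have hg : ∀ a ∈ m, ∀ w : m, a • g w = 0 := by
    intro a ha w
    rw [← map_smul]
    change Submodule.Quotient.mk (a * w.1) = (0 : A ⧸ m ^ 2)
    rw [Submodule.Quotient.mk_eq_zero, pow_two]
    exact Ideal.mul_mem_mul ha w.2
  let g' : (m ⧸ Ideal.span {x} • (⊤ : Submodule A m)) →ₗ[A] A ⧸ m ^ 2 :=
    Submodule.liftQ _ g (by
      rw [Submodule.smul_le]
      intro a ha w _
      rw [LinearMap.mem_ker, map_smul]
      exact hg a ((Ideal.span_singleton_le_iff_mem _).mpr hxm ha) w)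
  have key : ∀ z ∈ IsLocalRing.maximalIdeal (A ⧸ Ideal.span {x}) •
        (⊤ : Submodule (A ⧸ Ideal.span {x}) (m ⧸ Ideal.span {x} • (⊤ : Submodule A m))),
      g' z = 0 := by
    intro z hz
    refine Submodule.smul_induction_on (p := fun w => g' w = 0) hz ?_ ?_
    · intro b hb w _
      obtain ⟨b, rfl⟩ := Ideal.Quotient.mk_surjective b
      obtain ⟨w, rfl⟩ := Submodule.Quotient.mk_surjective _ w
      change g' (b • Submodule.Quotient.mk w) = 0
      rw [map_smul]
      refine hg b ?_ w
      rw [hm, IsLocalRing.mem_maximalIdeal, mem_nonunits_iff]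
      rw [IsLocalRing.mem_maximalIdeal, mem_nonunits_iff] at hb
      exact fun hu => hb (hu.map _)
    · intro a b ha hb
      rw [map_add, ha, hb, add_zero]
  have := key _ hmem
  change Submodule.Quotient.mk x = (0 : A ⧸ m ^ 2) at this
  rw [Submodule.Quotient.mk_eq_zero] at this
  exact hx2 this

lemma Lfree {A : Type u} [CommRing A] [IsLocalRing A]
    (h : Module.Free A (IsLocalRing.ResidueField A)) : IsLocalRing.maximalIdeal A = ⊥ := by
  rw [eq_bot_iff]
  intro a ha
  have h1 : a ∈ Module.annihilator A (IsLocalRing.ResidueField A) := by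
    rw [Module.mem_annihilator]
    intro t
    rw [Algebra.smul_def]
    have : algebraMap A (IsLocalRing.ResidueField A) a = 0 :=
      (IsLocalRing.residue_eq_zero_iff a).mpr ha
    rw [this, zero_mul]
  rwa [Module.annihilator_eq_bot.mpr inferInstance] at h1

lemma Lx {A : Type u} [CommRing A] [IsLocalRing A] [IsNoetherianRing A]
    (h0 : IsLocalRing.maximalIdeal A ≠ ⊥)
    (h : IsLocalRing.maximalIdeal A ∉ associatedPrimes A A) :
    ∃ x ∈ IsLocalRing.maximalIdeal A, x ∉ IsLocalRing.maximalIdeal A ^ 2 ∧ IsSMulRegular A x := by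
  set m := IsLocalRing.maximalIdeal A
  have hm2 : m ^ 2 ≠ m := by
    intro hh
    apply h0
    refine Submodule.eq_bot_of_le_smul_of_le_jacobson_bot m m (IsNoetherian.noetherian m) ?_
      (IsLocalRing.maximalIdeal_le_jacobson _)
    rw [smul_eq_mul, ← pow_two, hh]
  by_contra! hcon
  have := (Ideal.subset_iUnion_iff_mem_of_isMaximal_of_finite (M := m)
    (S := insert (m ^ 2) (associatedPrimes A A))
    ((associatedPrimes.finite A A).insert _) (m ^ 2) (m ^ 2) (by
      intro I hI hne _
      rcases hI with hI | hI
      · exact absurd hI hne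
      · exact hI.isPrime)
    (fun ht => Ideal.IsMaximal.ne_top (I := m) inferInstance
      (top_le_iff.mp (ht ▸ Ideal.pow_le_self two_ne_zero)))
    (fun ht => Ideal.IsMaximal.ne_top (I := m) inferInstance
      (top_le_iff.mp (ht ▸ Ideal.pow_le_self two_ne_zero)))).mp (by
      intro x hx
      rw [Set.biUnion_insert, biUnion_associatedPrimes_eq_compl_regular]
      by_cases hx2 : x ∈ m ^ 2
      · exact Or.inl hx2
      · exact Or.inr (hcon x hx hx2))
  rcases this with h1 | h1
  · exact hm2 h1.symm
  · exact h h1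

open Pointwise in
lemma Lmain (n : ℕ) : ∀ (A : Type u) [CommRing A] [IsLocalRing A] [IsNoetherianRing A],
    HasProjectiveDimensionLE (ModuleCat.of A (IsLocalRing.ResidueField A)) n →
    ∃ rs : List A, RingTheory.Sequence.IsWeaklyRegular A rs ∧
      Ideal.ofList rs = IsLocalRing.maximalIdeal A := by
  induction n with
  | zero =>
    intro A _ _ _ h
    have hp : Module.Projective A (IsLocalRing.ResidueField A) := by
      simp only [HasProjectiveDimensionLE, zero_add] at h
      rwa [← projective_iff_hasProjectiveDimensionLT_one, ← IsProjective.iff_projective] at h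
    have hfree : Module.Free A (IsLocalRing.ResidueField A) := Module.free_of_flat_of_isLocalRing
    exact ⟨[], by simp, by rw [Lfree hfree, Ideal.ofList_nil]⟩
  | succ n ih =>
    intro A _ _ _ h
    by_cases h0 : IsLocalRing.maximalIdeal A = ⊥
    · exact ⟨[], by simp, by rw [h0, Ideal.ofList_nil]⟩
    have hass : IsLocalRing.maximalIdeal A ∉ associatedPrimes A A := by
      intro hh
      rw [AssociatedPrimes.mem_iff, isAssociatedPrime_iff] at hh
      obtain ⟨hpr, s, hs⟩ := hh
      apply h0
      apply Lfree
      refine L1 s ?_ ?_ (n + 1) _ h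
      · rintro rfl
        apply hpr.ne_top
        rw [hs]
        simp
      · intro a ha
        rw [hs, Submodule.mem_colon_singleton] at ha
        rw [mul_comm]
        simpa using ha
    obtain ⟨x, hxm, hx2, hx⟩ := Lx h0 hass
    have hlt : Ideal.span {x} ≠ ⊤ := fun ht =>
      Ideal.IsMaximal.ne_top (I := IsLocalRing.maximalIdeal A) inferInstance
        (top_le_iff.mp (ht ▸ (Ideal.span_singleton_le_iff_mem _).mpr hxm))
    have : Nontrivial (A ⧸ Ideal.span {x}) := Ideal.Quotient.nontrivial_iff.mpr hlt
    have : IsLocalRing (A ⧸ Ideal.span {x}) :=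
      IsLocalRing.of_surjective' (Ideal.Quotient.mk _) Ideal.Quotient.mk_surjective
    have hmap : (IsLocalRing.maximalIdeal (A ⧸ Ideal.span {x})).comap
        (Ideal.Quotient.mk (Ideal.span {x})) = IsLocalRing.maximalIdeal A :=
      IsLocalRing.eq_maximalIdeal
        (Ideal.comap_isMaximal_of_surjective _ Ideal.Quotient.mk_surjective)
    have hxM : IsSMulRegular (IsLocalRing.maximalIdeal A) x := hx.submodule _ x
    have hpd := L2 x hx n (IsLocalRing.maximalIdeal A) hxM (L3' n h)
    have hpd2 := L3 _ (Submodule.Quotient.mk ⟨x, hxm⟩) (by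
      intro b hb
      obtain ⟨b, rfl⟩ := Ideal.Quotient.mk_surjective b
      have hb' : b ∈ IsLocalRing.maximalIdeal A := by rwa [← hmap]
      change Submodule.Quotient.mk (b • (⟨x, hxm⟩ : IsLocalRing.maximalIdeal A)) = _
      have e : b • (⟨x, hxm⟩ : IsLocalRing.maximalIdeal A) = x • ⟨b, hb'⟩ :=
        Subtype.ext (mul_comm b x)
      rw [e, Submodule.Quotient.mk_eq_zero]
      exact Submodule.smul_mem_smul (Ideal.mem_span_singleton_self x) trivial)
      (L3'' x hxm hx2) n hpd
    obtain ⟨rs, hrs, hspan⟩ := ih (A ⧸ Ideal.span {x}) hpd2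
    obtain ⟨ts, rfl⟩ := (List.map_surjective_iff.mpr
      (Ideal.Quotient.mk_surjective (I := Ideal.span {x}))) rs
    refine ⟨x :: ts, ?_, ?_⟩
    · rw [RingTheory.Sequence.isWeaklyRegular_cons_iff]
      refine ⟨hx, ?_⟩
      have h1 := (RingTheory.Sequence.isWeaklyRegular_map_algebraMap_iff
        (A ⧸ Ideal.span {x}) (A ⧸ Ideal.span {x}) ts).mp hrs
      have e : (x • (⊤ : Submodule A A)) = (Ideal.span {x} : Ideal A) := by
        rw [← Submodule.ideal_span_singleton_smul]
        simp
      exact (LinearEquiv.isWeaklyRegular_congr (Submodule.quotEquivOfEq _ _ e) ts).mpr h1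
    · rw [← hmap, ← hspan, ← Ideal.map_ofList,
        Ideal.comap_map_of_surjective _ Ideal.Quotient.mk_surjective, Ideal.ofList_cons, sup_comm,
        ← RingHom.ker_eq_comap_bot, Ideal.mk_ker]

/-- If `R_p` is not a regular local ring (i.e. its maximal ideal is not generated by a
regular sequence), then the residue field of `R_p` has infinite projective dimension over
`R_p`: there is no `n` such that `Ext^i_{R_p}(κ(p), -)` vanishes for all `i > n`. -/
theorem stmt18 {R : Type u} [CommRing R] [IsNoetherianRing R]
    (p : Ideal R) [p.IsPrime]
    (hreg : ¬ ∃ (c : ℕ) (f : Fin c → Localization.AtPrime p),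
      RingTheory.Sequence.IsRegular (Localization.AtPrime p) (List.ofFn f) ∧
      Ideal.span (Set.range f) = IsLocalRing.maximalIdeal (Localization.AtPrime p)) :
    ¬ ∃ n : ℕ, ∀ i : ℕ, n < i → ∀ N : ModuleCat.{u} (Localization.AtPrime p),
      Subsingleton
        (((Ext (Localization.AtPrime p) (ModuleCat.{u} (Localization.AtPrime p)) i).obj
          (op (ModuleCat.of (Localization.AtPrime p)
            (IsLocalRing.ResidueField (Localization.AtPrime p))))).obj N) := by
  rintro ⟨n, hn⟩
  obtain ⟨rs, hrs, hspan⟩ := Lmain n (Localization.AtPrime p) (L0 _ n hn)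
  refine hreg ⟨rs.length, rs.get, ?_, ?_⟩
  · rw [List.ofFn_get]
    refine RingTheory.Sequence.IsRegular.of_isWeaklyRegular_of_mem_maximalIdeal _ ?_ hrs
    intro r hr
    rw [← hspan]
    exact Ideal.subset_span hr
  · rw [← hspan]
    congr 1
    ext r
    simp [List.mem_iff_get]
end
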